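/- arXiv:2511.13070 — 3 statements merged into one kernel-verified Lean document; each statement's English description precedes it below -/
import Mathlib

section
/- Let p be a prime, r a nonnegative integer, and c > 1 a real constant; set α_n = c·(log n)/n. Suppose that for every n ≥ 2 and every k',l' ∈ {1,…,n}, q^{(n)}_{k'l'} is an α_n-balanced probability mass function on F_p, and let P_n denote the induced probability on M_n(F_p). For M ∈ M_n(F_p), let S_r(M) denote the number of surjective F_p-linear maps F : F_p^n → F_p^r such that F∘M = 0 (equivalently, the number of surjections from cok(M) = F_p^n/col(M) onto F_p^r). Then lim_{n→∞} Σ_{M ∈ M_n(F_p)} P_n(M)·S_r(M) = 1. -/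
set_option linter.unusedSectionVars false
set_option linter.unusedVariables false

section Aux
open Finset
open scoped Classical

namespace CokMoment

variable {p : ℕ} [Fact p.Prime] {G : Type} [AddCommGroup G] [Module (ZMod p) G] [Fintype G]
  {ι : Type} [Fintype ι] [DecidableEq ι]

/-- law of `m • x` in the group algebra -/
noncomputable def D (q : ZMod p → ℝ) (x : G) : AddMonoidAlgebra ℝ G :=
  ∑ a, AddMonoidAlgebra.single (a • x) (q a)

noncomputable def X (q : ι → ZMod p → ℝ) (f : ι → G) (A : Finset ι) : AddMonoidAlgebra ℝ G :=
  ∏ k ∈ A, D (q k) (f k)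

theorem coeff_single_mul' (g : G) (r : ℝ) (Y : AddMonoidAlgebra ℝ G) (y : G) :
    (AddMonoidAlgebra.single g r * Y).coeff y = r * Y.coeff (y - g) := by
  apply AddMonoidAlgebra.coeff_single_mul_eq_mul_coeff
  intro m _
  constructor
  · rintro rfl; simp
  · rintro rfl; simp

theorem coeff_mul' (Z Y : AddMonoidAlgebra ℝ G) (y : G) :
    (Z * Y).coeff y = ∑ z, Z.coeff z * Y.coeff (y - z) := by
  induction Z using AddMonoidAlgebra.induction_linear with
  | zero => simp
  | add a b ha hb => simp [add_mul, ha, hb, Finset.sum_add_distrib]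
  | single g r =>
    rw [coeff_single_mul']
    simp [AddMonoidAlgebra.coeff_single, Finsupp.single_apply]

theorem coeff_D_mul (q : ZMod p → ℝ) (x : G) (Y : AddMonoidAlgebra ℝ G) (y : G) :
    (D q x * Y).coeff y = ∑ a, q a * Y.coeff (y - a • x) := by
  simp only [D, Finset.sum_mul, AddMonoidAlgebra.coeff_sum, Finsupp.finsetSum_apply,
    coeff_single_mul']

theorem X_insert (q : ι → ZMod p → ℝ) (f : ι → G) {A : Finset ι} {k : ι} (h : k ∉ A) :
    X q f (insert k A) = D (q k) (f k) * X q f A := by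
  simp [X, Finset.prod_insert h]

theorem X_empty_coeff (q : ι → ZMod p → ℝ) (f : ι → G) (y : G) :
    (X q f ∅).coeff y = if y = 0 then 1 else 0 := by
  simp [X, AddMonoidAlgebra.one_def, AddMonoidAlgebra.coeff_single, Finsupp.single_apply, eq_comm]

theorem X_nonneg (q : ι → ZMod p → ℝ) (f : ι → G) (h0 : ∀ k a, 0 ≤ q k a) (A : Finset ι) :
    ∀ y, 0 ≤ (X q f A).coeff y := by
  induction A using Finset.induction_on with
  | empty => intro y; rw [X_empty_coeff]; split_ifs <;> norm_num
  | insert k A hk ih =>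
    intro y
    rw [X_insert q f hk, coeff_D_mul]
    exact Finset.sum_nonneg fun a _ => mul_nonneg (h0 k a) (ih _)

theorem X_sum (q : ι → ZMod p → ℝ) (f : ι → G) (h1 : ∀ k, ∑ a, q k a = 1) (A : Finset ι) :
    ∑ y, (X q f A).coeff y = 1 := by
  induction A using Finset.induction_on with
  | empty => simp [X_empty_coeff]
  | insert k A hk ih =>
    simp only [X_insert q f hk, coeff_D_mul]
    rw [Finset.sum_comm]
    simp only [← Finset.mul_sum]
    rw [← h1 k]
    refine Finset.sum_congr rfl fun a _ => ?_
    have e : ∑ y, (X q f A).coeff (y - a • f k) = ∑ y, (X q f A).coeff y :=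
      Fintype.sum_equiv (Equiv.subRight (a • f k)) _ _ (fun y => rfl)
    rw [e, ih, mul_one]

theorem X_supp (q : ι → ZMod p → ℝ) (f : ι → G) (H : Submodule (ZMod p) G) (A : Finset ι) :
    (∀ k ∈ A, f k ∈ H) → ∀ y, y ∉ H → (X q f A).coeff y = 0 := by
  induction A using Finset.induction_on with
  | empty =>
    intro _ y hy
    rw [X_empty_coeff, if_neg]
    rintro rfl; exact hy H.zero_mem
  | insert k A hk ih =>
    intro hA y hy
    rw [X_insert q f hk, coeff_D_mul]
    refine Finset.sum_eq_zero fun a _ => ?_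
    rw [ih (fun j hj => hA j (Finset.mem_insert_of_mem hj)), mul_zero]
    intro h
    apply hy
    have := H.add_mem h (H.smul_mem a (hA k (Finset.mem_insert_self _ _)))
    simpa using this

/-- rearrangement-type inequality -/
theorem rearr {κ : Type} [Fintype κ] [Nonempty κ] (q c : κ → ℝ) (α m : ℝ) (hα0 : 0 ≤ α) (hα : α ≤ 1 / 2)
    (hm : 1 / 2 ≤ m) (hm1 : m ≤ 1) (q0 : ∀ a, 0 ≤ q a) (q1 : ∑ a, q a = 1) (qb : ∀ a, q a ≤ 1 - α)
    (c0 : ∀ a, 0 ≤ c a) (c1 : ∑ a, c a ≤ 1) (cb : ∀ a, c a ≤ m) :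
    ∑ a, q a * c a ≤ (1 - α) * m + α * (1 - m) := by
  obtain ⟨s, hs⟩ := Finite.exists_max c
  by_cases hμ : c s ≤ 1 / 2
  · calc ∑ a, q a * c a ≤ ∑ a, q a * (1 / 2) :=
          Finset.sum_le_sum fun a _ => mul_le_mul_of_nonneg_left ((hs a).trans hμ) (q0 a)
      _ = 1 / 2 := by rw [← Finset.sum_mul, q1]; norm_num
      _ ≤ _ := by nlinarith
  · push Not at hμ
    have h2 : ∀ a, a ≠ s → c a ≤ 1 - c s := by
      intro a ha
      have : c a + c s ≤ ∑ b, c b := by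
        rw [← Finset.sum_pair ha]
        exact Finset.sum_le_sum_of_subset_of_nonneg (Finset.subset_univ _) fun b _ _ => c0 b
      linarith
    have e1 : ∑ a, q a * c a = q s * c s + ∑ a ∈ univ.erase s, q a * c a :=
      (Finset.add_sum_erase _ _ (mem_univ s)).symm
    have e2 : ∑ a, q a = q s + ∑ a ∈ univ.erase s, q a :=
      (Finset.add_sum_erase _ _ (mem_univ s)).symm
    have e3 : ∑ a ∈ univ.erase s, q a * c a ≤ (1 - q s) * (1 - c s) := by
      calc _ ≤ ∑ a ∈ univ.erase s, q a * (1 - c s) :=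
            Finset.sum_le_sum fun a ha => mul_le_mul_of_nonneg_left (h2 a (ne_of_mem_erase ha)) (q0 a)
        _ = _ := by rw [← Finset.sum_mul]; congr 1; linarith
    have := qb s
    have := cb s
    rw [e1]
    nlinarith [mul_nonneg (sub_nonneg.2 (qb s)) (by linarith : 0 ≤ 2 * c s - 1),
      mul_nonneg (sub_nonneg.2 (cb s)) (by linarith : 0 ≤ 1 - 2 * α)]

theorem X_mass (q : ι → ZMod p → ℝ) (f : ι → G) (h0 : ∀ k a, 0 ≤ q k a) (h1 : ∀ k, ∑ a, q k a = 1)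
    (α : ℝ) (hα0 : 0 ≤ α) (hα : α ≤ 1 / 2) (hb : ∀ k a, q k a ≤ 1 - α)
    (H : Submodule (ZMod p) G) (A : Finset ι) :
    (∀ k ∈ A, f k ∉ H) → ∀ z, (∑ y, if y - z ∈ H then (X q f A).coeff y else 0) ≤
      (1 + (1 - 2 * α) ^ A.card) / 2 := by
  induction A using Finset.induction_on with
  | empty =>
    intro _ z
    have h := X_sum q f h1 ∅
    have : (∑ y, if y - z ∈ H then (X q f ∅).coeff y else 0) ≤ ∑ y, (X q f ∅).coeff y := by
      refine Finset.sum_le_sum fun y _ => ?_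
      have := X_nonneg q f h0 ∅ y
      split_ifs <;> linarith
    simp; linarith
  | insert k A hk ih =>
    intro hA z
    have ih' := ih (fun j hj => hA j (Finset.mem_insert_of_mem hj))
    have hfk := hA k (Finset.mem_insert_self _ _)
    set C : G → ℝ := fun z => ∑ y, if y - z ∈ H then (X q f A).coeff y else 0 with hC
    have key : (∑ y, if y - z ∈ H then (X q f (insert k A)).coeff y else 0) =
        ∑ a, q k a * C (z - a • f k) := by
      simp only [X_insert q f hk, coeff_D_mul, hC]
      have : ∀ y, (if y - z ∈ H then ∑ a, q k a * (X q f A).coeff (y - a • f k) else 0) =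
          ∑ a, q k a * (if y - z ∈ H then (X q f A).coeff (y - a • f k) else 0) := by
        intro y; split_ifs <;> simp
      simp only [this]
      rw [Finset.sum_comm]
      refine Finset.sum_congr rfl fun a _ => ?_
      rw [← Finset.mul_sum]
      congr 1
      refine Fintype.sum_equiv (Equiv.subRight (a • f k)) _ _ fun y => ?_
      have : y - a • f k - (z - a • f k) = y - z := by abel
      simp [this]
    rw [key]
    have hpow0 : 0 ≤ (1 - 2 * α) ^ A.card := pow_nonneg (by linarith) _
    have hpow1 : (1 - 2 * α) ^ A.card ≤ 1 := pow_le_one₀ (by linarith) (by linarith)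
    have hX0 := X_nonneg q f h0 A
    have hr := rearr (q k) (fun a => C (z - a • f k)) α ((1 + (1 - 2 * α) ^ A.card) / 2) hα0 hα
      (by linarith) (by linarith) (h0 k) (h1 k) (hb k) ?_ ?_ (fun a => ih' _)
    · refine hr.trans (le_of_eq ?_)
      rw [Finset.card_insert_of_notMem hk, pow_succ]; ring
    · intro a
      refine Finset.sum_nonneg fun y _ => ?_
      split_ifs
      · exact hX0 y
      · exact le_rfl
    · rw [← X_sum q f h1 A]
      simp only [hC]
      rw [Finset.sum_comm]
      refine Finset.sum_le_sum fun y _ => ?_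
      by_cases hex : ∃ a : ZMod p, y - (z - a • f k) ∈ H
      · obtain ⟨a, ha⟩ := hex
        rw [Finset.sum_eq_single a]
        · rw [if_pos ha]
        · intro b _ hba
          rw [if_neg]
          intro hbm
          have h3 := H.sub_mem hbm ha
          have h4 : y - (z - b • f k) - (y - (z - a • f k)) = (b - a) • f k := by
            rw [sub_smul]; abel
          rw [h4] at h3
          exact hfk ((H.smul_mem_iff (sub_ne_zero.2 hba)).1 h3)
        · intro h; exact absurd (mem_univ _) h
      · push Not at hex
        rw [Finset.sum_eq_zero]
        · exact hX0 y
        · intro a _; rw [if_neg (hex a)]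

/-- characteristic function -/
noncomputable def phi (q : ZMod p → ℝ) (χ : AddChar G ℂ) (x : G) : ℂ :=
  ∑ a, (q a : ℂ) * χ (a • x)

theorem X_hat (q : ι → ZMod p → ℝ) (f : ι → G) (χ : AddChar G ℂ) (A : Finset ι) :
    ∑ y, ((X q f A).coeff y : ℂ) * χ y = ∏ k ∈ A, phi (q k) χ (f k) := by
  induction A using Finset.induction_on with
  | empty =>
    rw [Finset.sum_eq_single 0]
    · simp [X_empty_coeff]
    · intro y _ hy; simp [X_empty_coeff, hy]
    · simp
  | insert k A hk ih =>
    rw [Finset.prod_insert hk, ← ih]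
    simp only [X_insert q f hk, coeff_D_mul, phi]
    push_cast
    simp only [Finset.sum_mul]
    rw [Finset.sum_comm]
    refine Finset.sum_congr rfl fun a _ => ?_
    rw [Finset.mul_sum]
    refine Fintype.sum_equiv (Equiv.subRight (a • f k)) _ _ fun y => ?_
    have : χ y = χ (a • f k) * χ (y - a • f k) := by
      rw [← AddChar.map_add_eq_mul]; congr 1; abel
    simp only [Equiv.subRight_apply]
    rw [this]; ring

theorem X_inv (q : ι → ZMod p → ℝ) (f : ι → G) (A : Finset ι) (y : G) :
    (Fintype.card G : ℂ) * ((X q f A).coeff y : ℂ) =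
      ∑ χ : AddChar G ℂ, χ (-y) * ∏ k ∈ A, phi (q k) χ (f k) := by
  simp only [← X_hat, Finset.mul_sum]
  rw [Finset.sum_comm]
  have : ∀ z, ∑ χ : AddChar G ℂ, χ (-y) * (((X q f A).coeff z : ℂ) * χ z) =
      ((X q f A).coeff z : ℂ) * if z - y = 0 then (Fintype.card G : ℂ) else 0 := by
    intro z
    rw [← AddChar.sum_apply_eq_ite, Finset.mul_sum]
    refine Finset.sum_congr rfl fun χ _ => ?_
    rw [sub_eq_add_neg, AddChar.map_add_eq_mul]; ring
  simp only [this, sub_eq_zero]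
  simp [mul_comm]

end CokMoment
end Aux
set_option linter.unusedSectionVars false
set_option linter.unusedVariables false

section Aux
open Finset
open scoped Classical

namespace CokMoment

variable {p : ℕ} [Fact p.Prime] {G : Type} [AddCommGroup G] [Module (ZMod p) G] [Fintype G]
  {ι : Type} [Fintype ι] [DecidableEq ι]

noncomputable def U (q : ZMod p → ℝ) (χ : AddChar G ℂ) (x : G) : ℝ :=
  ∑ a, ∑ b, q a * q b * (1 - (χ ((a - b) • x)).re)

noncomputable def sig (q : ZMod p → ℝ) : ℝ := 1 - ∑ a, q a * q a

noncomputable def w (q : ZMod p → ℝ) (χ : AddChar G ℂ) (x : G) : ℝ := U q χ x / sig q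

noncomputable def HF (H : Submodule (ZMod p) G) : Finset G := univ.filter (· ∈ H)

def NT (χ : AddChar G ℂ) (H : Submodule (ZMod p) G) : Prop := ∃ h ∈ H, χ h ≠ 1

theorem sig_eq (q : ZMod p → ℝ) (h1 : ∑ a, q a = 1) :
    sig q = ∑ a, ∑ b, q a * q b * (if a = b then 0 else 1) := by
  have e : (1 : ℝ) = ∑ a, ∑ b, q a * q b := by
    rw [← Finset.sum_mul_sum, h1]; norm_num
  have this : ∀ a b, q a * q b * (if a = b then (0:ℝ) else 1) =
      q a * q b - if a = b then q a * q b else 0 := by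
    intro a b; split_ifs <;> simp
  simp only [this, Finset.sum_sub_distrib]
  rw [← e, sig]
  simp

theorem normSq_phi (q : ZMod p → ℝ) (h1 : ∑ a, q a = 1) (χ : AddChar G ℂ) (x : G) :
    ‖phi q χ x‖ ^ 2 = 1 - U q χ x := by
  have e : (1 : ℝ) = ∑ a, ∑ b, q a * q b := by
    rw [← Finset.sum_mul_sum, h1]; norm_num
  have e2 : 1 - U q χ x = ∑ a, ∑ b, q a * q b * (χ ((a - b) • x)).re := by
    simp only [U, mul_sub, Finset.sum_sub_distrib, mul_one]
    rw [← e]; ring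
  rw [e2]
  have e3 : ((‖phi q χ x‖ ^ 2 : ℝ) : ℂ) = phi q χ x * (starRingEnd ℂ) (phi q χ x) := by
    rw [Complex.mul_conj, Complex.normSq_eq_norm_sq]
  have e4 : ‖phi q χ x‖ ^ 2 = (phi q χ x * (starRingEnd ℂ) (phi q χ x)).re := by
    rw [← e3, Complex.ofReal_re]
  rw [e4, phi, map_sum, Finset.sum_mul_sum, Complex.re_sum]
  refine Finset.sum_congr rfl fun a _ => ?_
  rw [Complex.re_sum]
  refine Finset.sum_congr rfl fun b _ => ?_
  have : (q a : ℂ) * χ (a • x) * (starRingEnd ℂ) ((q b : ℂ) * χ (b • x)) =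
      ((q a * q b : ℝ) : ℂ) * χ ((a - b) • x) := by
    rw [map_mul, Complex.conj_ofReal, ← AddChar.map_neg_eq_conj, sub_smul, sub_eq_add_neg,
      AddChar.map_add_eq_mul]
    push_cast; ring
  rw [this, Complex.re_ofReal_mul]

theorem re_le_one (χ : AddChar G ℂ) (x : G) : (χ x).re ≤ 1 := by
  have := Complex.re_le_norm (χ x)
  rwa [AddChar.norm_apply] at this

theorem neg_one_le_re (χ : AddChar G ℂ) (x : G) : -1 ≤ (χ x).re := by
  have := Complex.abs_re_le_norm (χ x)
  rw [AddChar.norm_apply] at this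
  exact (abs_le.1 this).1

theorem exists_gamma (G : Type) [AddCommGroup G] [Fintype G] :
    ∃ γ : ℝ, 0 < γ ∧ ∀ (χ : AddChar G ℂ) (y : G), χ y ≠ 1 → γ ≤ 1 - (χ y).re := by
  obtain ⟨s, hs⟩ := Finite.exists_min
    (fun z : AddChar G ℂ × G => if z.1 z.2 = 1 then (1 : ℝ) else 1 - (z.1 z.2).re)
  refine ⟨_, ?_, fun χ y h => (hs (χ, y)).trans ?_⟩
  · show 0 < (if s.1 s.2 = 1 then (1 : ℝ) else 1 - (s.1 s.2).re)
    split_ifs with h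
    · norm_num
    · have h1 := Complex.re_le_norm (s.1 s.2)
      have h2 := AddChar.norm_apply s.1 s.2
      rw [h2] at h1
      rcases h1.lt_or_eq with h3 | h3
      · linarith
      · exfalso; apply h
        have h4 := Complex.sq_norm (s.1 s.2)
        rw [h2, Complex.normSq_apply, h3] at h4
        apply Complex.ext
        · simpa using h3
        · have : (s.1 s.2).im * (s.1 s.2).im = 0 := by linarith
          simpa using this
  · simp [h]

theorem U_nonneg (q : ZMod p → ℝ) (h0 : ∀ a, 0 ≤ q a) (χ : AddChar G ℂ) (x : G) : 0 ≤ U q χ x :=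
  Finset.sum_nonneg fun a _ => Finset.sum_nonneg fun b _ =>
    mul_nonneg (mul_nonneg (h0 a) (h0 b)) (by linarith [re_le_one χ ((a - b) • x)])

theorem U_le (q : ZMod p → ℝ) (h0 : ∀ a, 0 ≤ q a) (h1 : ∑ a, q a = 1) (χ : AddChar G ℂ) (x : G) :
    U q χ x ≤ 2 * sig q := by
  rw [sig_eq q h1, U, Finset.mul_sum]
  refine Finset.sum_le_sum fun a _ => ?_
  rw [Finset.mul_sum]
  refine Finset.sum_le_sum fun b _ => ?_
  have := neg_one_le_re χ ((a - b) • x)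
  have := mul_nonneg (h0 a) (h0 b)
  split_ifs with h
  · subst h; simp
  · nlinarith

theorem char_smul_ne (χ : AddChar G ℂ) (x : G) (hx : χ x ≠ 1) (c : ZMod p) (hc : c ≠ 0) :
    χ (c • x) ≠ 1 := by
  intro h
  apply hx
  have e : x = (c⁻¹).val • (c • x) := by
    rw [← Nat.cast_smul_eq_nsmul (ZMod p), ZMod.natCast_zmod_val, smul_smul, inv_mul_cancel₀ hc,
      one_smul]
  rw [e, AddChar.map_nsmul_eq_pow, h, one_pow]

theorem U_ge (q : ZMod p → ℝ) (h0 : ∀ a, 0 ≤ q a) (h1 : ∑ a, q a = 1) (χ : AddChar G ℂ) (x : G)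
    (hx : χ x ≠ 1) (γ : ℝ) (hγ : ∀ (χ : AddChar G ℂ) (y : G), χ y ≠ 1 → γ ≤ 1 - (χ y).re) :
    γ * sig q ≤ U q χ x := by
  rw [sig_eq q h1, U, Finset.mul_sum]
  refine Finset.sum_le_sum fun a _ => ?_
  rw [Finset.mul_sum]
  refine Finset.sum_le_sum fun b _ => ?_
  have := mul_nonneg (h0 a) (h0 b)
  split_ifs with h
  · subst h; simp
  · have := hγ χ ((a - b) • x) (char_smul_ne χ x hx _ (sub_ne_zero.2 h))
    nlinarith

theorem char_sum_H (χ : AddChar G ℂ) (H : Submodule (ZMod p) G) (hH : NT χ H) (c : ZMod p)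
    (hc : c ≠ 0) : ∑ x ∈ HF H, χ (c • x) = 0 := by
  obtain ⟨h, hh, hne⟩ := hH
  have e : ∑ x ∈ HF H, χ (c • x) = ∑ x ∈ HF H, χ (c • (x + c⁻¹ • h)) := by
    symm
    refine Finset.sum_equiv (Equiv.addRight (c⁻¹ • h)) ?_ ?_
    · intro x
      simp only [HF, mem_filter, mem_univ, true_and, Equiv.coe_addRight]
      exact (H.add_mem_iff_left (H.smul_mem _ hh)).symm
    · intro x _; rfl
  have e2 : ∀ x, χ (c • (x + c⁻¹ • h)) = χ (c • x) * χ h := by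
    intro x
    rw [smul_add, AddChar.map_add_eq_mul, smul_smul, mul_inv_cancel₀ hc, one_smul]
  simp only [e2, ← Finset.sum_mul] at e
  have : (∑ x ∈ HF H, χ (c • x)) * (χ h - 1) = 0 := by
    rw [mul_sub, ← e]; ring
  exact (mul_eq_zero.1 this).resolve_right (sub_ne_zero.2 hne)

theorem U_sum (q : ZMod p → ℝ) (h1 : ∑ a, q a = 1) (χ : AddChar G ℂ) (H : Submodule (ZMod p) G)
    (hH : NT χ H) : ∑ x ∈ HF H, U q χ x = (HF H).card * sig q := by
  simp only [U]
  rw [Finset.sum_comm, sig_eq q h1, Finset.mul_sum]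
  refine Finset.sum_congr rfl fun a _ => ?_
  rw [Finset.sum_comm, Finset.mul_sum]
  refine Finset.sum_congr rfl fun b _ => ?_
  rw [← Finset.mul_sum, Finset.sum_sub_distrib]
  split_ifs with h
  · subst h; simp
  · have := char_sum_H χ H hH (a - b) (sub_ne_zero.2 h)
    rw [← Complex.re_sum, this]
    simp; ring

theorem card_perp (H : Submodule (ZMod p) G) :
    ((univ.filter fun χ : AddChar G ℂ => ¬ NT χ H).card : ℝ) * (HF H).card = Fintype.card G := by
  have e : ∑ χ : AddChar G ℂ, ∑ x ∈ HF H, χ x = (Fintype.card G : ℂ) := by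
    rw [Finset.sum_comm]
    simp only [AddChar.sum_apply_eq_ite]
    simp [HF]
  have e2 : ∀ χ : AddChar G ℂ, ∑ x ∈ HF H, χ x = if ¬ NT χ H then ((HF H).card : ℂ) else 0 := by
    intro χ
    by_cases h : NT χ H
    · simpa [h] using char_sum_H χ H h 1 one_ne_zero
    · have : ∀ x ∈ HF H, χ x = 1 := by
        intro x hx
        by_contra hne
        exact h ⟨x, by simpa [HF] using hx, hne⟩
      rw [Finset.sum_congr rfl this]; simp [h]
  simp only [e2] at e
  rw [← Finset.sum_filter, Finset.sum_const, nsmul_eq_mul] at e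
  exact_mod_cast e

theorem HF_card_pos (H : Submodule (ZMod p) G) : 0 < (HF H).card :=
  Finset.card_pos.2 ⟨0, by simp [HF]⟩

theorem HF_card_le (H : Submodule (ZMod p) G) : (HF H).card ≤ Fintype.card G :=
  Finset.card_le_univ _

/-! consequences for balanced q -/

theorem sig_ge (q : ZMod p → ℝ) (h0 : ∀ a, 0 ≤ q a) (h1 : ∑ a, q a = 1) (α : ℝ) (hα0 : 0 ≤ α)
    (hα : α ≤ 1 / 2) (hb : ∀ a, q a ≤ 1 - α) : 2 * α * (1 - α) ≤ sig q := by
  have := rearr q q α (1 - α) hα0 hα (by linarith) (by linarith) h0 h1 hb h0 h1.le hb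
  rw [sig]; nlinarith

theorem norm_phi_le (q : ZMod p → ℝ) (h0 : ∀ a, 0 ≤ q a) (h1 : ∑ a, q a = 1) (α : ℝ) (hα0 : 0 < α)
    (hα : α ≤ 1 / 2) (hb : ∀ a, q a ≤ 1 - α) (χ : AddChar G ℂ) (x : G) :
    ‖phi q χ x‖ ≤ Real.exp (-(α * (1 - α) * w q χ x)) := by
  have hs := sig_ge q h0 h1 α hα0.le hα hb
  have hs0 : 0 < sig q := lt_of_lt_of_le (by nlinarith) hs
  have hU := U_nonneg q h0 χ x
  have hw : 0 ≤ w q χ x := div_nonneg hU hs0.le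
  have hUw : U q χ x = w q χ x * sig q := by rw [w, div_mul_cancel₀ _ hs0.ne']
  have h2 : ‖phi q χ x‖ ^ 2 ≤ Real.exp (-(α * (1 - α) * w q χ x)) ^ 2 := by
    rw [normSq_phi q h1, ← Real.exp_nat_mul]
    have := Real.add_one_le_exp (-(2 * (α * (1 - α) * w q χ x)))
    have h3 : 2 * (α * (1 - α) * w q χ x) ≤ U q χ x := by rw [hUw]; nlinarith
    calc 1 - U q χ x ≤ -(2 * (α * (1 - α) * w q χ x)) + 1 := by linarith
      _ ≤ _ := this
      _ = _ := by congr 1; push_cast; ring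
  exact le_of_sq_le_sq h2 (Real.exp_pos _).le

theorem chernoff (q : ZMod p → ℝ) (h0 : ∀ a, 0 ≤ q a) (h1 : ∑ a, q a = 1) (hs0 : 0 < sig q)
    (χ : AddChar G ℂ) (H : Submodule (ZMod p) G) (hH : NT χ H) (t : ℝ) (ht : 0 ≤ t) (ht2 : t ≤ 1 / 2) :
    ∑ x ∈ HF H, Real.exp (-(t * w q χ x)) ≤ (HF H).card * Real.exp (-t + 2 * t ^ 2) := by
  have hpt : ∀ x, Real.exp (-(t * w q χ x)) ≤ 1 - (t - 2 * t ^ 2) * w q χ x := by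
    intro x
    have hw0 : 0 ≤ w q χ x := div_nonneg (U_nonneg q h0 χ x) hs0.le
    have hw2 : w q χ x ≤ 2 := by rw [w, div_le_iff₀ hs0]; exact U_le q h0 h1 χ x
    have h3 : |(-(t * w q χ x))| ≤ 1 := by
      rw [abs_neg, abs_of_nonneg (by positivity)]; nlinarith
    have h4 := (abs_le.1 (Real.abs_exp_sub_one_sub_id_le h3)).2
    have h5 : t ^ 2 * (w q χ x) ^ 2 ≤ 2 * t ^ 2 * w q χ x := by nlinarith [sq_nonneg t, mul_nonneg (sq_nonneg t) (mul_nonneg hw0 (sub_nonneg.2 hw2))]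
    nlinarith
  calc _ ≤ ∑ x ∈ HF H, (1 - (t - 2 * t ^ 2) * w q χ x) := Finset.sum_le_sum fun x _ => hpt x
    _ = (HF H).card * (1 - (t - 2 * t ^ 2)) := by
      rw [Finset.sum_sub_distrib, ← Finset.mul_sum]
      have : ∑ x ∈ HF H, w q χ x = (HF H).card := by
        simp only [w, ← Finset.sum_div]
        rw [U_sum q h1 χ H hH, mul_div_assoc, div_self hs0.ne', mul_one]
      rw [this]; simp; ring
    _ ≤ _ := by
      refine mul_le_mul_of_nonneg_left ?_ (Nat.cast_nonneg _)
      have := Real.add_one_le_exp (-t + 2 * t ^ 2)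
      linarith

end CokMoment
end Aux
set_option linter.unusedSectionVars false
set_option linter.unusedVariables false

section Aux
open Finset
open scoped Classical

namespace CokMoment

variable {p : ℕ} [Fact p.Prime] {G : Type} [AddCommGroup G] [Module (ZMod p) G] [Fintype G]
  {ι : Type} [Fintype ι] [DecidableEq ι]

noncomputable def NTF (H : Submodule (ZMod p) G) : Finset (AddChar G ℂ) := univ.filter fun χ => NT χ H

theorem NTF_card (H : Submodule (ZMod p) G) : (NTF H).card ≤ Fintype.card G := by
  rw [← AddChar.card_eq (α := G)]; exact Finset.card_le_univ _

theorem norm_phi_le_one (q : ZMod p → ℝ) (h0 : ∀ a, 0 ≤ q a) (h1 : ∑ a, q a = 1)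
    (χ : AddChar G ℂ) (x : G) : ‖phi q χ x‖ ≤ 1 := by
  have h := normSq_phi q h1 χ x
  have := U_nonneg q h0 χ x
  nlinarith [norm_nonneg (phi q χ x)]

theorem Q_bound (q : ι → ZMod p → ℝ) (f : ι → G) (h0 : ∀ k a, 0 ≤ q k a) (h1 : ∀ k, ∑ a, q k a = 1)
    (H : Submodule (ZMod p) G) (S : Finset ι) (y : G) :
    (X q f S).coeff y ≤ ((HF H).card : ℝ)⁻¹ * (1 + ∑ χ ∈ NTF H, ∏ k ∈ S, ‖phi (q k) χ (f k)‖) := by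
  have hH : (0 : ℝ) < (HF H).card := by exact_mod_cast HF_card_pos H
  have hHG : ((HF H).card : ℝ) ≤ Fintype.card G := by exact_mod_cast HF_card_le H
  have hG : (0 : ℝ) < Fintype.card G := hH.trans_le hHG
  have e := X_inv q f S y
  have hX := X_nonneg q f h0 S y
  have e1 : (Fintype.card G : ℝ) * (X q f S).coeff y ≤
      ∑ χ : AddChar G ℂ, ∏ k ∈ S, ‖phi (q k) χ (f k)‖ := by
    have : (Fintype.card G : ℝ) * (X q f S).coeff y =
        ‖(Fintype.card G : ℂ) * ((X q f S).coeff y : ℂ)‖ := by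
      rw [norm_mul, Complex.norm_natCast, Complex.norm_real, Real.norm_of_nonneg hX]
    rw [this, e]
    refine (norm_sum_le _ _).trans (Finset.sum_le_sum fun χ _ => ?_)
    rw [norm_mul, AddChar.norm_apply, one_mul, norm_prod]
  have e2 : ∑ χ : AddChar G ℂ, ∏ k ∈ S, ‖phi (q k) χ (f k)‖ ≤
      (Fintype.card G : ℝ) / (HF H).card + ∑ χ ∈ NTF H, ∏ k ∈ S, ‖phi (q k) χ (f k)‖ := by
    rw [← Finset.sum_filter_not_add_sum_filter (p := fun χ => NT χ H)]
    refine add_le_add ?_ le_rfl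
    calc _ ≤ ∑ χ ∈ univ.filter (fun χ : AddChar G ℂ => ¬ NT χ H), (1 : ℝ) :=
          Finset.sum_le_sum fun χ _ => Finset.prod_le_one (fun _ _ => norm_nonneg _)
            fun k _ => norm_phi_le_one _ (h0 k) (h1 k) _ _
      _ = _ := by
        rw [← card_perp H]; simp; field_simp
  have e3 : 0 ≤ ∑ χ ∈ NTF H, ∏ k ∈ S, ‖phi (q k) χ (f k)‖ :=
    Finset.sum_nonneg fun χ _ => Finset.prod_nonneg fun _ _ => norm_nonneg _
  have e4 := e1.trans e2
  set Y := ∑ χ ∈ NTF H, ∏ k ∈ S, ‖phi (q k) χ (f k)‖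
  rw [← mul_le_mul_iff_right₀ hG]
  refine e4.trans ?_
  rw [← mul_assoc, ← div_eq_mul_inv, mul_add, mul_one]
  refine add_le_add le_rfl ?_
  have : 1 ≤ (Fintype.card G : ℝ) / (HF H).card := by rwa [one_le_div hH]
  nlinarith

theorem P_split (q : ι → ZMod p → ℝ) (f : ι → G) (h0 : ∀ k a, 0 ≤ q k a) (h1 : ∀ k, ∑ a, q k a = 1)
    (α : ℝ) (hα0 : 0 ≤ α) (hα : α ≤ 1 / 2) (hb : ∀ k a, q k a ≤ 1 - α)
    (H : Submodule (ZMod p) G) (T : Finset ι) (hT : ∀ k, k ∈ T ↔ f k ∉ H) :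
    (X q f univ).coeff 0 ≤ (1 + (1 - 2 * α) ^ T.card) / 2 *
      (((HF H).card : ℝ)⁻¹ * (1 + ∑ χ ∈ NTF H, ∏ k ∈ Tᶜ, ‖phi (q k) χ (f k)‖)) := by
  set Q := ((HF H).card : ℝ)⁻¹ * (1 + ∑ χ ∈ NTF H, ∏ k ∈ Tᶜ, ‖phi (q k) χ (f k)‖)
  have e : X q f univ = X q f T * X q f Tᶜ := by
    simp only [X]; exact (Finset.prod_mul_prod_compl T _).symm
  have hsupp := X_supp q f H Tᶜ (by intro k hk; simpa [hT] using hk)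
  have hm := X_mass q f h0 h1 α hα0 hα hb H T (fun k hk => (hT k).1 hk) 0
  have hQ := Q_bound q f h0 h1 H Tᶜ
  have hQ0 : 0 ≤ Q := (X_nonneg q f h0 Tᶜ 0).trans (hQ 0)
  rw [e, coeff_mul']
  calc _ ≤ ∑ z, (if z - 0 ∈ H then (X q f T).coeff z else 0) * Q := by
        refine Finset.sum_le_sum fun z _ => ?_
        rw [sub_zero, zero_sub]
        split_ifs with h
        · exact mul_le_mul_of_nonneg_left (hQ _) (X_nonneg q f h0 T z)
        · rw [hsupp _ (by simpa using h)]; simp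
    _ ≤ _ := by
        rw [← Finset.sum_mul]
        exact mul_le_mul_of_nonneg_right hm hQ0

theorem P_lower (q : ι → ZMod p → ℝ) (f : ι → G) :
    1 - ∑ χ ∈ NTF (⊤ : Submodule (ZMod p) G), ∏ k, ‖phi (q k) χ (f k)‖ +
      (∏ k, (∑ a, q k a) - 1) ≤ (Fintype.card G : ℝ) * (X q f univ).coeff 0 := by
  have e := X_inv q f univ 0
  simp only [neg_zero, AddChar.map_zero_eq_one, one_mul] at e
  have e' := congrArg Complex.re e
  have e0 : ((Fintype.card G : ℂ) * ((X q f univ).coeff 0 : ℂ)).re =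
      (Fintype.card G : ℝ) * (X q f univ).coeff 0 := by
    rw [← Complex.ofReal_natCast, ← Complex.ofReal_mul, Complex.ofReal_re]
  rw [e0] at e'
  rw [e', Complex.re_sum, ← Finset.add_sum_erase _ _ (mem_univ (0 : AddChar G ℂ))]
  have e1 : (∏ k, phi (q k) (0 : AddChar G ℂ) (f k)).re = ∏ k, (∑ a, q k a) := by
    have : ∀ k, phi (q k) (0 : AddChar G ℂ) (f k) = ((∑ a, q k a : ℝ) : ℂ) := by
      intro k; simp [phi]
    simp only [this, ← Complex.ofReal_prod, Complex.ofReal_re]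
  have e2 : -(∑ χ ∈ NTF (⊤ : Submodule (ZMod p) G), ∏ k, ‖phi (q k) χ (f k)‖) ≤
      ∑ χ ∈ univ.erase (0 : AddChar G ℂ), (∏ k, phi (q k) χ (f k)).re := by
    rw [← Finset.sum_neg_distrib]
    have hset : NTF (⊤ : Submodule (ZMod p) G) = univ.erase (0 : AddChar G ℂ) := by
      ext χ
      simp only [NTF, NT, mem_filter, mem_univ, true_and, mem_erase, and_true, Submodule.mem_top]
      exact (AddChar.ne_zero_iff).symm
    rw [hset]
    refine Finset.sum_le_sum fun χ _ => ?_
    have := (abs_le.1 (Complex.abs_re_le_norm (∏ k, phi (q k) χ (f k)))).1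
    rwa [norm_prod] at this
  rw [e1]
  linarith

/-- pointwise product bound -/
theorem prod_phi_le (q : ι → ZMod p → ℝ) (f : ι → G) (h0 : ∀ k a, 0 ≤ q k a) (h1 : ∀ k, ∑ a, q k a = 1)
    (α : ℝ) (hα0 : 0 < α) (hα : α ≤ 1 / 2) (hb : ∀ k a, q k a ≤ 1 - α) (χ : AddChar G ℂ)
    (S : Finset ι) (b : ℝ) (hS : b ≤ ∑ k ∈ S, w (q k) χ (f k)) :
    ∏ k ∈ S, ‖phi (q k) χ (f k)‖ ≤ Real.exp (-(α * (1 - α) * b)) := by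
  calc _ ≤ ∏ k ∈ S, Real.exp (-(α * (1 - α) * w (q k) χ (f k))) :=
        Finset.prod_le_prod (fun _ _ => norm_nonneg _)
          fun k _ => norm_phi_le _ (h0 k) (h1 k) α hα0 hα (hb k) _ _
    _ = Real.exp (-(α * (1 - α) * ∑ k ∈ S, w (q k) χ (f k))) := by
        rw [← Real.exp_sum, Finset.mul_sum, Finset.sum_neg_distrib]
    _ ≤ _ := by
        apply Real.exp_le_exp.2
        have : 0 ≤ α * (1 - α) := mul_nonneg hα0.le (by linarith)
        nlinarith

theorem sum_w_ge (q : ι → ZMod p → ℝ) (f : ι → G) (h0 : ∀ k a, 0 ≤ q k a) (h1 : ∀ k, ∑ a, q k a = 1)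
    (α : ℝ) (hα0 : 0 < α) (hα : α ≤ 1 / 2) (hb : ∀ k a, q k a ≤ 1 - α) (χ : AddChar G ℂ)
    (S : Finset ι) (γ : ℝ)
    (hγ : ∀ (χ : AddChar G ℂ) (y : G), χ y ≠ 1 → γ ≤ 1 - (χ y).re) :
    γ * (S.filter fun k => χ (f k) ≠ 1).card ≤ ∑ k ∈ S, w (q k) χ (f k) := by
  have hs : ∀ k, 0 < sig (q k) := fun k =>
    lt_of_lt_of_le (by nlinarith) (sig_ge _ (h0 k) (h1 k) α hα0.le hα (hb k))
  calc _ = ∑ k ∈ S.filter fun k => χ (f k) ≠ 1, γ := by simp [mul_comm]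
    _ ≤ ∑ k ∈ S.filter fun k => χ (f k) ≠ 1, w (q k) χ (f k) := by
        refine Finset.sum_le_sum fun k hk => ?_
        rw [w, le_div_iff₀ (hs k)]
        exact U_ge _ (h0 k) (h1 k) _ _ (mem_filter.1 hk).2 γ hγ
    _ ≤ _ := Finset.sum_le_sum_of_subset_of_nonneg (filter_subset _ _) fun k _ _ =>
        div_nonneg (U_nonneg _ (h0 k) _ _) (hs k).le

/-- counting the tuples with an exceptional character -/
theorem bad_count1 (q : ι → ZMod p → ℝ) (h0 : ∀ k a, 0 ≤ q k a) (h1 : ∀ k, ∑ a, q k a = 1)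
    (α : ℝ) (hα0 : 0 < α) (hα : α ≤ 1 / 2) (hb : ∀ k a, q k a ≤ 1 - α) (χ : AddChar G ℂ)
    (H : Submodule (ZMod p) G) (hH : NT χ H) (T : Finset ι) (e : ℝ) (he0 : 0 ≤ e) (he : e ≤ 1) :
    (((Fintype.piFinset fun k : ι => if k ∈ T then (univ : Finset G) else HF H).filter
      fun f => ∑ k ∈ Tᶜ, w (q k) χ (f k) < (1 - e) * (Tᶜ).card).card : ℝ) ≤
      (Fintype.card G : ℝ) ^ T.card * ((HF H).card : ℝ) ^ (Tᶜ).card *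
        Real.exp (-(e ^ 2 / 8 * (Tᶜ).card)) := by
  have hs : ∀ k, 0 < sig (q k) := fun k =>
    lt_of_lt_of_le (by nlinarith) (sig_ge _ (h0 k) (h1 k) α hα0.le hα (hb k))
  set t := e / 4 with ht
  have hpt : ∀ f ∈ (Fintype.piFinset fun k : ι => if k ∈ T then (univ : Finset G) else HF H),
      (if ∑ k ∈ Tᶜ, w (q k) χ (f k) < (1 - e) * (Tᶜ).card then (1 : ℝ) else 0) ≤
      Real.exp (t * (1 - e) * (Tᶜ).card) *
        ∏ k, (if k ∈ T then 1 else Real.exp (-(t * w (q k) χ (f k)))) := by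
    intro f _
    have e1 : ∏ k, (if k ∈ T then 1 else Real.exp (-(t * w (q k) χ (f k)))) =
        Real.exp (-(t * ∑ k ∈ Tᶜ, w (q k) χ (f k))) := by
      rw [Finset.mul_sum, ← Finset.sum_neg_distrib, Real.exp_sum,
        ← Finset.prod_mul_prod_compl T, Finset.prod_congr rfl (fun k hk => if_pos hk),
        Finset.prod_const_one, one_mul]
      exact Finset.prod_congr rfl (fun k hk => if_neg (by simpa using hk))
    rw [e1, ← Real.exp_add]
    split_ifs with h
    · apply Real.one_le_exp
      have : 0 ≤ t := by positivity
      nlinarith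
    · exact (Real.exp_pos _).le
  rw [Finset.card_filter]
  push_cast
  refine (Finset.sum_le_sum hpt).trans ?_
  rw [← Finset.mul_sum, ← Finset.prod_univ_sum (fun k : ι => if k ∈ T then (univ : Finset G) else HF H)
    (fun k x => if k ∈ T then (1:ℝ) else Real.exp (-(t * w (q k) χ x))),
    ← Finset.prod_mul_prod_compl T]
  have e2 : ∏ k ∈ T, ∑ x ∈ (if k ∈ T then (univ : Finset G) else HF H),
      (if k ∈ T then (1:ℝ) else Real.exp (-(t * w (q k) χ x))) = (Fintype.card G : ℝ) ^ T.card := by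
    rw [← Finset.prod_const]
    refine Finset.prod_congr rfl fun k hk => ?_
    simp [hk]
  have e3 : ∏ k ∈ Tᶜ, ∑ x ∈ (if k ∈ T then (univ : Finset G) else HF H),
      (if k ∈ T then (1:ℝ) else Real.exp (-(t * w (q k) χ x))) ≤
      (((HF H).card : ℝ) * Real.exp (-t + 2 * t ^ 2)) ^ (Tᶜ).card := by
    rw [← Finset.prod_const]
    refine Finset.prod_le_prod (fun k hk => Finset.sum_nonneg fun x _ => ?_) fun k hk => ?_
    · split_ifs
      · norm_num
      · exact (Real.exp_pos _).le
    · have hk' : k ∉ T := by simpa using hk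
      simp only [hk', if_false]
      exact chernoff _ (h0 k) (h1 k) (hs k) χ H hH t (by positivity) (by rw [ht]; linarith)
  rw [e2]
  calc _ ≤ Real.exp (t * (1 - e) * (Tᶜ).card) * ((Fintype.card G : ℝ) ^ T.card *
        (((HF H).card : ℝ) * Real.exp (-t + 2 * t ^ 2)) ^ (Tᶜ).card) := by gcongr
    _ = (Fintype.card G : ℝ) ^ T.card * ((HF H).card : ℝ) ^ (Tᶜ).card *
        (Real.exp (t * (1 - e) * (Tᶜ).card) * Real.exp (-t + 2 * t ^ 2) ^ (Tᶜ).card) := by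
        rw [mul_pow]; ring
    _ = _ := by
        rw [← Real.exp_nat_mul, ← Real.exp_add]
        congr 2
        rw [ht]; ring

end CokMoment
end Aux
set_option linter.unusedSectionVars false
set_option linter.unusedVariables false

section Aux
open Finset
open scoped Classical

namespace CokMoment

variable {p : ℕ} [Fact p.Prime] {G : Type} [AddCommGroup G] [Module (ZMod p) G] [Fintype G]

noncomputable def Ptot {n : ℕ} (q : Fin n → Fin n → ZMod p → ℝ) (f : Fin n → G) : ℝ :=
  ∏ l, (X (fun k => q k l) f univ).coeff 0

def Typ {n : ℕ} (θ : ℝ) (H : Submodule (ZMod p) G) (T : Finset (Fin n)) (f : Fin n → G) : Prop :=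
  (∀ k, k ∈ T ↔ f k ∉ H) ∧
    ∀ χ : AddChar G ℂ, NT χ H → θ * n ≤ ((Tᶜ).filter fun k => χ (f k) ≠ 1).card

def Bad {n : ℕ} (q : Fin n → Fin n → ZMod p → ℝ) (e : ℝ) (H : Submodule (ZMod p) G)
    (T : Finset (Fin n)) (f : Fin n → G) : Prop :=
  ∃ l, ∃ χ : AddChar G ℂ, NT χ H ∧ ∑ k ∈ Tᶜ, w (q k l) χ (f k) < (1 - e) * (Tᶜ).card

noncomputable def Pi0 {n : ℕ} (H : Submodule (ZMod p) G) (T : Finset (Fin n)) :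
    Finset (Fin n → G) :=
  Fintype.piFinset fun k : Fin n => if k ∈ T then (univ : Finset G) else HF H

theorem Pi0_card {n : ℕ} (H : Submodule (ZMod p) G) (T : Finset (Fin n)) :
    ((Pi0 H T).card : ℝ) = (Fintype.card G : ℝ) ^ T.card * ((HF H).card : ℝ) ^ (Tᶜ).card := by
  rw [Pi0, Fintype.card_piFinset, ← Finset.prod_mul_prod_compl T]
  push_cast
  congr 1
  · rw [← Finset.prod_const]
    exact Finset.prod_congr rfl fun k hk => by simp [hk]
  · rw [← Finset.prod_const]
    exact Finset.prod_congr rfl fun k hk => by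
      have : k ∉ T := by simpa using hk
      simp [this]

theorem bad_count {n : ℕ} (q : Fin n → Fin n → ZMod p → ℝ) (h0 : ∀ k l a, 0 ≤ q k l a)
    (h1 : ∀ k l, ∑ a, q k l a = 1)
    (α : ℝ) (hα0 : 0 < α) (hα : α ≤ 1 / 2) (hb : ∀ k l a, q k l a ≤ 1 - α)
    (H : Submodule (ZMod p) G) (T : Finset (Fin n)) (e : ℝ) (he0 : 0 ≤ e) (he : e ≤ 1) :
    (((Pi0 H T).filter (Bad q e H T)).card : ℝ) ≤ n * Fintype.card G *
      Real.exp (-(e ^ 2 / 8 * (Tᶜ).card)) * (Pi0 H T).card := by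
  have hsub : (Pi0 H T).filter (Bad q e H T) ⊆ (univ ×ˢ NTF H : Finset (Fin n × AddChar G ℂ)).biUnion
      fun z => (Pi0 H T).filter fun f => ∑ k ∈ Tᶜ, w (q k z.1) z.2 (f k) < (1 - e) * (Tᶜ).card := by
    intro f hf
    obtain ⟨hf1, l, χ, hχ, hlt⟩ := mem_filter.1 hf
    refine mem_biUnion.2 ⟨(l, χ), ?_, mem_filter.2 ⟨hf1, hlt⟩⟩
    simp [NTF, hχ]
  have h2 := (Finset.card_le_card hsub).trans Finset.card_biUnion_le
  have h3 : (((Pi0 H T).filter (Bad q e H T)).card : ℝ) ≤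
      ∑ z ∈ (univ ×ˢ NTF H : Finset (Fin n × AddChar G ℂ)),
      (((Pi0 H T).filter fun f => ∑ k ∈ Tᶜ, w (q k z.1) z.2 (f k) < (1 - e) * (Tᶜ).card).card : ℝ) := by
    exact_mod_cast h2
  refine h3.trans ?_
  calc _ ≤ ∑ z ∈ (univ ×ˢ NTF H : Finset (Fin n × AddChar G ℂ)),
        (Real.exp (-(e ^ 2 / 8 * (Tᶜ).card)) * (Pi0 H T).card) := by
        refine Finset.sum_le_sum fun z hz => ?_
        rw [Pi0_card]
        have hz2 : NT z.2 H := by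
          have := (mem_product.1 hz).2
          simpa [NTF] using this
        exact (bad_count1 (fun k => q k z.1) (fun k => h0 k _) (fun k => h1 k _) α hα0 hα
          (fun k => hb k _) z.2 H hz2 T e he0 he).trans (le_of_eq (by ring))
    _ ≤ _ := by
        rw [Finset.sum_const, nsmul_eq_mul, card_product, card_univ, Fintype.card_fin, mul_assoc]
        push_cast
        have : ((NTF H).card : ℝ) ≤ Fintype.card G := by exact_mod_cast NTF_card H
        gcongr

theorem P_nonneg {n : ℕ} (q : Fin n → Fin n → ZMod p → ℝ) (h0 : ∀ k l a, 0 ≤ q k l a)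
    (f : Fin n → G) : 0 ≤ Ptot q f :=
  Finset.prod_nonneg fun l _ => X_nonneg _ f (fun k => h0 k l) univ 0

theorem Ptot_le {n : ℕ} (q : Fin n → Fin n → ZMod p → ℝ) (h0 : ∀ k l a, 0 ≤ q k l a)
    (h1 : ∀ k l, ∑ a, q k l a = 1)
    (α : ℝ) (hα0 : 0 < α) (hα : α ≤ 1 / 2) (hb : ∀ k l a, q k l a ≤ 1 - α)
    (H : Submodule (ZMod p) G) (T : Finset (Fin n)) (f : Fin n → G) (hT : ∀ k, k ∈ T ↔ f k ∉ H)
    (b : ℝ) (hw : ∀ l, ∀ χ : AddChar G ℂ, NT χ H → b ≤ ∑ k ∈ Tᶜ, w (q k l) χ (f k)) :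
    Ptot q f ≤ ((1 + (1 - 2 * α) ^ T.card) / 2) ^ n * (((HF H).card : ℝ)⁻¹) ^ n *
      (1 + Fintype.card G * Real.exp (-(α * (1 - α) * b))) ^ n := by
  rw [← mul_pow, ← mul_pow]
  have hm0 : 0 ≤ (1 + (1 - 2 * α) ^ T.card) / 2 := by
    have : 0 ≤ (1 - 2 * α) ^ T.card := pow_nonneg (by linarith) _
    linarith
  calc Ptot q f ≤ ∏ l : Fin n, ((1 + (1 - 2 * α) ^ T.card) / 2 * (((HF H).card : ℝ)⁻¹) *
      (1 + Fintype.card G * Real.exp (-(α * (1 - α) * b)))) := by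
        refine Finset.prod_le_prod (fun l _ => X_nonneg _ f (fun k => h0 k l) univ 0) fun l _ => ?_
        refine (P_split (fun k => q k l) f (fun k => h0 k l) (fun k => h1 k l) α hα0.le hα
          (fun k => hb k l) H T hT).trans ?_
        rw [← mul_assoc]
        refine mul_le_mul_of_nonneg_left ?_ (mul_nonneg hm0 (by positivity))
        gcongr
        calc _ ≤ ∑ χ ∈ NTF H, Real.exp (-(α * (1 - α) * b)) := by
              refine Finset.sum_le_sum fun χ hχ => ?_
              exact prod_phi_le (fun k => q k l) f (fun k => h0 k l) (fun k => h1 k l) α hα0 hα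
                (fun k => hb k l) χ Tᶜ b (hw l χ (by simpa [NTF] using hχ))
          _ ≤ _ := by
              rw [Finset.sum_const, nsmul_eq_mul]
              have : ((NTF H).card : ℝ) ≤ Fintype.card G := by exact_mod_cast NTF_card H
              gcongr
    _ = _ := by simp

theorem typ_sum {n : ℕ} (q : Fin n → Fin n → ZMod p → ℝ) (h0 : ∀ k l a, 0 ≤ q k l a)
    (h1 : ∀ k l, ∑ a, q k l a = 1)
    (α : ℝ) (hα0 : 0 < α) (hα : α ≤ 1 / 2) (hb : ∀ k l a, q k l a ≤ 1 - α)
    (H : Submodule (ZMod p) G) (T : Finset (Fin n)) (e : ℝ) (he0 : 0 ≤ e) (he : e ≤ 1)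
    (θ γ : ℝ) (hγ0 : 0 < γ)
    (hγ : ∀ (χ : AddChar G ℂ) (y : G), χ y ≠ 1 → γ ≤ 1 - (χ y).re) :
    ∑ f ∈ univ.filter (Typ θ H T), Ptot q f ≤
      ((1 + (1 - 2 * α) ^ T.card) / 2) ^ n * (Fintype.card G : ℝ) ^ T.card *
      ((1 + Fintype.card G * Real.exp (-(α * (1 - α) * ((1 - e) * (Tᶜ).card)))) ^ n +
        n * Fintype.card G * Real.exp (-(e ^ 2 / 8 * (Tᶜ).card)) *
        (1 + Fintype.card G * Real.exp (-(α * (1 - α) * (γ * (θ * n))))) ^ n) := by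
  set A := (1 + Fintype.card G * Real.exp (-(α * (1 - α) * ((1 - e) * (Tᶜ).card)))) ^ n with hA
  set B := (1 + Fintype.card G * Real.exp (-(α * (1 - α) * (γ * (θ * n))))) ^ n with hB
  have hA0 : 0 ≤ A := by positivity
  have hB0 : 0 ≤ B := by positivity
  set m := ((1 + (1 - 2 * α) ^ T.card) / 2) ^ n with hm
  have hm0 : 0 ≤ m := by
    have : 0 ≤ (1 - 2 * α) ^ T.card := pow_nonneg (by linarith) _
    positivity
  set h := (((HF H).card : ℝ)⁻¹) ^ n with hh
  have hh0 : 0 ≤ h := by positivity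
  have hpt : ∀ f ∈ univ.filter (Typ θ H T),
      Ptot q f ≤ m * h * (A + if Bad q e H T f then B else 0) := by
    intro f hf
    have hf' : Typ θ H T f := (mem_filter.1 hf).2
    split_ifs with hbad
    · have := Ptot_le q h0 h1 α hα0 hα hb H T f hf'.1 (γ * (θ * n)) (fun l χ hχ =>
        (mul_le_mul_of_nonneg_left (hf'.2 χ hχ) hγ0.le).trans
          (sum_w_ge (fun k => q k l) f (fun k => h0 k l) (fun k => h1 k l) α hα0 hα
            (fun k => hb k l) χ Tᶜ γ hγ))
      refine this.trans (mul_le_mul_of_nonneg_left (by linarith) (by positivity))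
    · rw [add_zero]
      refine Ptot_le q h0 h1 α hα0 hα hb H T f hf'.1 _ (fun l χ hχ => ?_)
      by_contra hlt
      exact hbad ⟨l, χ, hχ, not_le.1 hlt⟩
  have hsub : univ.filter (Typ θ H T) ⊆ Pi0 H T := by
    intro f hf
    have hf' : Typ θ H T f := (mem_filter.1 hf).2
    rw [Pi0, Fintype.mem_piFinset]
    intro k
    split_ifs with hk
    · exact mem_univ _
    · rw [hf'.1 k, not_not] at hk
      simpa [HF] using hk
  have hcard : h * (Pi0 H T).card ≤ (Fintype.card G : ℝ) ^ T.card := by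
    rw [Pi0_card, hh]
    have hH1 : (1 : ℝ) ≤ (HF H).card := by exact_mod_cast HF_card_pos H
    have : ((HF H).card : ℝ) ^ (Tᶜ).card ≤ ((HF H).card : ℝ) ^ n :=
      pow_le_pow_right₀ hH1 (by simpa using Finset.card_le_univ Tᶜ)
    have h5 : (((HF H).card : ℝ)⁻¹) ^ n * ((HF H).card : ℝ) ^ (Tᶜ).card ≤ 1 := by
      rw [inv_pow, inv_mul_le_one₀ (by positivity)]; exact this
    calc _ = (Fintype.card G : ℝ) ^ T.card *
          ((((HF H).card : ℝ)⁻¹) ^ n * ((HF H).card : ℝ) ^ (Tᶜ).card) := by ring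
      _ ≤ _ := mul_le_of_le_one_right (by positivity) h5
  have hbc := bad_count q h0 h1 α hα0 hα hb H T e he0 he
  set K := n * Fintype.card G * Real.exp (-(e ^ 2 / 8 * (Tᶜ).card)) with hK
  calc _ ≤ ∑ f ∈ univ.filter (Typ θ H T), m * h * (A + if Bad q e H T f then B else 0) :=
        Finset.sum_le_sum hpt
    _ ≤ ∑ f ∈ Pi0 H T, m * h * (A + if Bad q e H T f then B else 0) := by
        refine Finset.sum_le_sum_of_subset_of_nonneg hsub fun f _ _ => ?_
        split_ifs <;> positivity
    _ = m * h * ((Pi0 H T).card * A + ((Pi0 H T).filter (Bad q e H T)).card * B) := by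
        rw [← Finset.mul_sum, Finset.sum_add_distrib, ← Finset.sum_filter]
        simp
    _ ≤ m * h * ((Pi0 H T).card * A + (K * (Pi0 H T).card) * B) := by gcongr
    _ = m * (h * (Pi0 H T).card) * (A + K * B) := by ring
    _ ≤ _ := by
        have : 0 ≤ K := by positivity
        gcongr

/-- every tuple has a type -/
theorem exists_typ {n : ℕ} (θ : ℝ) (hθ : 0 ≤ θ) (f : Fin n → G) :
    ∃ (H : Submodule (ZMod p) G) (T : Finset (Fin n)), Typ θ H T f ∧
      (T.card : ℝ) ≤ θ * n * Fintype.card G := by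
  obtain ⟨H, hH⟩ := Finite.exists_min (fun H : Submodule (ZMod p) G =>
    ((univ.filter fun k => f k ∉ H).card : ℝ) + θ * n * (HF H).card)
  refine ⟨H, univ.filter fun k => f k ∉ H, ⟨by simp, fun χ hχ => ?_⟩, ?_⟩
  · let H' : Submodule (ZMod p) G :=
      { carrier := {x | x ∈ H ∧ ∀ c : ZMod p, χ (c • x) = 1}
        add_mem' := by
          rintro a b ⟨ha, ha'⟩ ⟨hb, hb'⟩
          refine ⟨H.add_mem ha hb, fun c => ?_⟩
          rw [smul_add, AddChar.map_add_eq_mul, ha', hb', one_mul]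
        zero_mem' := ⟨H.zero_mem, fun c => by simp⟩
        smul_mem' := by
          rintro c x ⟨hx, hx'⟩
          refine ⟨H.smul_mem c hx, fun d => ?_⟩
          rw [smul_smul]; exact hx' _ }
    have hmem : ∀ x, x ∈ H' ↔ x ∈ H ∧ χ x = 1 := by
      intro x
      constructor
      · rintro ⟨h, h'⟩; exact ⟨h, by simpa using h' 1⟩
      · rintro ⟨h, h'⟩
        refine ⟨h, fun c => ?_⟩
        rw [← ZMod.natCast_zmod_val c, Nat.cast_smul_eq_nsmul, AddChar.map_nsmul_eq_pow, h', one_pow]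
    have hlt : (HF H').card + 1 ≤ (HF H).card := by
      apply Finset.card_lt_card
      rw [Finset.ssubset_iff_of_subset]
      · obtain ⟨x, hx, hne⟩ := hχ
        exact ⟨x, by simpa [HF] using hx, by simp [HF, hmem, hne]⟩
      · intro x hx
        have : x ∈ H' := by simpa [HF] using hx
        simpa [HF] using ((hmem x).1 this).1
    have hc : (univ.filter fun k => f k ∉ H').card ≤ (univ.filter fun k => f k ∉ H).card +
        ((univ.filter fun k => f k ∉ H)ᶜ.filter fun k => χ (f k) ≠ 1).card := by
      refine (Finset.card_le_card ?_).trans (Finset.card_union_le _ _)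
      intro k hk
      simp only [mem_filter, mem_univ, true_and, hmem, mem_union, mem_compl] at hk ⊢
      tauto
    have h1 := hH H'
    have hlt' : ((HF H').card : ℝ) + 1 ≤ (HF H).card := by exact_mod_cast hlt
    have hc' : ((univ.filter fun k => f k ∉ H').card : ℝ) ≤ (univ.filter fun k => f k ∉ H).card +
        ((univ.filter fun k => f k ∉ H)ᶜ.filter fun k => χ (f k) ≠ 1).card := by exact_mod_cast hc
    have hθn : 0 ≤ θ * n := by positivity
    nlinarith
  · have h1 := hH ⊤
    have e : (univ.filter fun k => f k ∉ (⊤ : Submodule (ZMod p) G)) = ∅ := by simp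
    have e2 : HF (⊤ : Submodule (ZMod p) G) = univ := by simp [HF]
    simp only [e, e2, card_empty, card_univ] at h1
    have : 0 ≤ θ * n * (HF H).card := by positivity
    push_cast at h1
    linarith

end CokMoment
end Aux
set_option linter.unusedSectionVars false
set_option linter.unusedVariables false

section Aux
open Finset
open scoped Classical

namespace CokMoment

variable {p : ℕ} [Fact p.Prime] {G : Type} [AddCommGroup G] [Module (ZMod p) G] [Fintype G]

noncomputable def Sp (p : ℕ) [Fact p.Prime] (G : Type) [AddCommGroup G] [Module (ZMod p) G] [Fintype G]
    (n : ℕ) : Finset (Fin n → G) :=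
  univ.filter fun f => Submodule.span (ZMod p) (Set.range f) = ⊤

noncomputable def Zs (g α δ : ℝ) (n : ℕ) : ℝ :=
  ∑ T ∈ univ.filter (fun T : Finset (Fin n) => T ≠ ∅ ∧ (T.card : ℝ) ≤ δ * n),
    ((1 + (1 - 2 * α) ^ T.card) / 2) ^ n * g ^ T.card

noncomputable def Rs (g α δ e η : ℝ) (n : ℕ) : ℝ :=
  (1 + g * Real.exp (-(α * (1 - α) * ((1 - e) * ((1 - δ) * n))))) ^ n +
    n * g * Real.exp (-(e ^ 2 / 8 * ((1 - δ) * n))) *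
      (1 + g * Real.exp (-(α * (1 - α) * (η * n)))) ^ n

theorem upper {n : ℕ} (q : Fin n → Fin n → ZMod p → ℝ) (h0 : ∀ k l a, 0 ≤ q k l a)
    (h1 : ∀ k l, ∑ a, q k l a = 1)
    (α : ℝ) (hα0 : 0 < α) (hα : α ≤ 1 / 2) (hb : ∀ k l a, q k l a ≤ 1 - α)
    (e : ℝ) (he0 : 0 ≤ e) (he : e ≤ 1)
    (θ γ : ℝ) (hθ : 0 ≤ θ) (hγ0 : 0 < γ)
    (hγ : ∀ (χ : AddChar G ℂ) (y : G), χ y ≠ 1 → γ ≤ 1 - (χ y).re) :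
    ∑ f ∈ Sp p G n, Ptot q f ≤
      Rs (Fintype.card G) α (θ * Fintype.card G) e (γ * θ) n *
        (1 + Fintype.card (Submodule (ZMod p) G) *
          Zs (Fintype.card G) α (θ * Fintype.card G) n) := by
  set g : ℝ := (Fintype.card G : ℝ) with hg
  set δ := θ * g with hδ
  set R := Rs g α δ e (γ * θ) n with hR
  have hg0 : 0 ≤ g := by positivity
  let m : Finset (Fin n) → ℝ := fun T => ((1 + (1 - 2 * α) ^ T.card) / 2) ^ n * g ^ T.card
  have hm0 : ∀ T, 0 ≤ m T := by
    intro T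
    have : 0 ≤ (1 - 2 * α) ^ T.card := pow_nonneg (by linarith) _
    positivity
  have hα1 : 0 ≤ α * (1 - α) := mul_nonneg hα0.le (by linarith)
  -- single type
  have hty : ∀ (H : Submodule (ZMod p) G) (T : Finset (Fin n)), (T.card : ℝ) ≤ δ * n →
      ∑ f ∈ univ.filter (Typ θ H T), Ptot q f ≤ m T * R := by
    intro H T hT
    refine (typ_sum q h0 h1 α hα0 hα hb H T e he0 he θ γ hγ0 hγ).trans ?_
    refine mul_le_mul_of_nonneg_left ?_ (hm0 T)
    have hc : (1 - δ) * n ≤ ((Tᶜ).card : ℝ) := by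
      have h3 : (T.card : ℝ) + (Tᶜ).card = n := by
        have := Finset.card_add_card_compl T
        rw [Fintype.card_fin] at this
        exact_mod_cast this
      linarith
    have hee : 0 ≤ 1 - e := by linarith
    rw [hR, Rs, mul_assoc γ θ]
    gcongr
  let Adm : Finset (Submodule (ZMod p) G × Finset (Fin n)) :=
    insert (⊤, ∅) (univ ×ˢ univ.filter (fun T : Finset (Fin n) => T ≠ ∅ ∧ (T.card : ℝ) ≤ δ * n))
  have hcov : ∀ f ∈ Sp p G n, ∃ z ∈ Adm, Typ θ z.1 z.2 f := by
    intro f hf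
    obtain ⟨H, T, hty, hc⟩ := exists_typ (p := p) θ hθ f
    refine ⟨(H, T), ?_, hty⟩
    by_cases hT : T = ∅
    · have : H = ⊤ := by
        have hs : Submodule.span (ZMod p) (Set.range f) = ⊤ := (mem_filter.1 hf).2
        rw [eq_top_iff, ← hs, Submodule.span_le]
        rintro _ ⟨k, rfl⟩
        by_contra hk
        have := (hty.1 k).2 hk
        simp [hT] at this
      subst this; subst hT
      exact mem_insert_self _ _
    · refine mem_insert_of_mem ?_
      simp only [mem_product, mem_univ, mem_filter, true_and]
      refine ⟨hT, hc.trans (le_of_eq ?_)⟩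
      rw [hδ]; ring
  have hadm : ∀ z ∈ Adm, (z.2.card : ℝ) ≤ δ * n := by
    intro z hz
    rcases mem_insert.1 hz with rfl | hz
    · simp; positivity
    · exact (mem_filter.1 (mem_product.1 hz).2).2.2
  calc ∑ f ∈ Sp p G n, Ptot q f
      ≤ ∑ f ∈ Sp p G n, ∑ z ∈ Adm, if Typ θ z.1 z.2 f then Ptot q f else 0 := by
        refine Finset.sum_le_sum fun f hf => ?_
        obtain ⟨z, hz, hzt⟩ := hcov f hf
        have hp := P_nonneg q h0 f
        calc Ptot q f = if Typ θ z.1 z.2 f then Ptot q f else 0 := by rw [if_pos hzt]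
          _ ≤ _ := Finset.single_le_sum (f := fun z : Submodule (ZMod p) G × Finset (Fin n) =>
              if Typ θ z.1 z.2 f then Ptot q f else 0)
              (fun z _ => by split_ifs <;> simp [hp]) hz
    _ = ∑ z ∈ Adm, ∑ f ∈ Sp p G n, if Typ θ z.1 z.2 f then Ptot q f else 0 := Finset.sum_comm
    _ ≤ ∑ z ∈ Adm, ∑ f ∈ univ.filter (Typ θ z.1 z.2), Ptot q f := by
        refine Finset.sum_le_sum fun z _ => ?_
        rw [Finset.sum_filter]
        refine Finset.sum_le_sum_of_subset_of_nonneg (subset_univ _) fun f _ _ => ?_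
        have hp := P_nonneg q h0 f
        split_ifs <;> simp [hp]
    _ ≤ ∑ z ∈ Adm, m z.2 * R := Finset.sum_le_sum fun z hz => hty z.1 z.2 (hadm z hz)
    _ = _ := by
        rw [← Finset.sum_mul, Finset.sum_insert, Finset.sum_product]
        · simp [m, Zs]; ring
        · simp

theorem span_of_not_bad {n : ℕ} (hn : 0 < n) (q : Fin n → Fin n → ZMod p → ℝ) (e : ℝ) (he : e < 1)
    (f : Fin n → G) (hf : ¬ Bad q e (⊤ : Submodule (ZMod p) G) ∅ f) : f ∈ Sp p G n := by
  refine mem_filter.2 ⟨mem_univ _, ?_⟩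
  by_contra hne
  set H := Submodule.span (ZMod p) (Set.range f)
  apply hf
  obtain ⟨x, hx⟩ : ∃ x, x ∉ H := by
    by_contra hcon
    push Not at hcon
    exact hne (eq_top_iff.2 fun x _ => hcon x)
  have hx' : (H.mkQ x) ≠ 0 := by simpa using hx
  have : Finite (G ⧸ H) := Finite.of_surjective H.mkQ H.mkQ_surjective
  obtain ⟨ψ, hψ⟩ := AddChar.exists_apply_ne_zero.2 hx'
  let χ : AddChar G ℂ := ψ.compAddMonoidHom H.mkQ.toAddMonoidHom
  have hχ : ∀ y ∈ H, χ y = 1 := by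
    intro y hy
    have : H.mkQ y = 0 := by simpa using hy
    show ψ (H.mkQ y) = 1
    rw [this, AddChar.map_zero_eq_one]
  refine ⟨⟨0, hn⟩, χ, ⟨x, Submodule.mem_top, hψ⟩, ?_⟩
  have hw : ∀ k, w (q k ⟨0, hn⟩) χ (f k) = 0 := by
    intro k
    have : U (q k ⟨0, hn⟩) χ (f k) = 0 := by
      refine Finset.sum_eq_zero fun a _ => Finset.sum_eq_zero fun b _ => ?_
      rw [hχ _ (H.smul_mem _ (Submodule.subset_span ⟨k, rfl⟩))]
      simp
    rw [w, this, zero_div]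
  simp only [hw, Finset.sum_const_zero, compl_empty, card_univ, Fintype.card_fin]
  have : (0 : ℝ) < n := by exact_mod_cast hn
  exact mul_pos (by linarith) this

theorem lower {n : ℕ} (hn : 0 < n) (q : Fin n → Fin n → ZMod p → ℝ) (h0 : ∀ k l a, 0 ≤ q k l a)
    (h1 : ∀ k l, ∑ a, q k l a = 1)
    (α : ℝ) (hα0 : 0 < α) (hα : α ≤ 1 / 2) (hb : ∀ k l a, q k l a ≤ 1 - α)
    (e : ℝ) (he0 : 0 ≤ e) (he : e < 1)
    (hpos : 0 ≤ 1 - Fintype.card G * Real.exp (-(α * (1 - α) * ((1 - e) * n)))) :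
    (1 - n * Fintype.card G * Real.exp (-(e ^ 2 / 8 * n))) *
      (1 - Fintype.card G * Real.exp (-(α * (1 - α) * ((1 - e) * n)))) ^ n ≤
    ∑ f ∈ Sp p G n, Ptot q f := by
  set g : ℝ := (Fintype.card G : ℝ) with hg
  have hg0 : 0 < g := by
    have : 0 < Fintype.card G := Fintype.card_pos
    rw [hg]
    exact Nat.cast_pos.2 this
  set L := 1 - g * Real.exp (-(α * (1 - α) * ((1 - e) * n))) with hL
  have hP : ∀ f : Fin n → G, ¬ Bad q e (⊤ : Submodule (ZMod p) G) ∅ f → (g⁻¹ * L) ^ n ≤ Ptot q f := by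
    intro f hf
    have : (g⁻¹ * L) ^ n = ∏ l : Fin n, (g⁻¹ * L) := by simp
    rw [this, Ptot]
    refine Finset.prod_le_prod (fun l _ => by positivity) fun l _ => ?_
    have h3 := P_lower (fun k => q k l) f
    simp only [h1, Finset.prod_const_one, sub_self, add_zero] at h3
    rw [inv_mul_le_iff₀ hg0]
    refine le_trans ?_ h3
    rw [hL]
    refine sub_le_sub_left ?_ _
    calc _ ≤ ∑ χ ∈ NTF (⊤ : Submodule (ZMod p) G), Real.exp (-(α * (1 - α) * ((1 - e) * n))) := by
              refine Finset.sum_le_sum fun χ hχ => ?_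
              refine prod_phi_le (fun k => q k l) f (fun k => h0 k l) (fun k => h1 k l) α hα0 hα
                (fun k => hb k l) χ univ _ ?_
              by_contra hlt
              refine hf ⟨l, χ, by simpa [NTF] using hχ, ?_⟩
              simpa using hlt
      _ ≤ _ := by
              rw [Finset.sum_const, nsmul_eq_mul]
              have : ((NTF (⊤ : Submodule (ZMod p) G)).card : ℝ) ≤ g := by
                rw [hg]; exact_mod_cast NTF_card _
              gcongr
  have hPi : Pi0 (⊤ : Submodule (ZMod p) G) (∅ : Finset (Fin n)) = univ := by
    ext f; simp [Pi0, HF]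
  have hbc := bad_count q h0 h1 α hα0 hα hb (⊤ : Submodule (ZMod p) G) ∅ e he0 he.le
  rw [hPi] at hbc
  have hun : ((univ : Finset (Fin n → G)).card : ℝ) = g ^ n := by
    rw [card_univ, Fintype.card_fun, Fintype.card_fin]; push_cast; rfl
  rw [hun] at hbc
  simp only [compl_empty, card_univ, Fintype.card_fin] at hbc
  have hcompl : ((univ.filter (Bad q e (⊤ : Submodule (ZMod p) G) ∅)).card : ℝ) +
      ((univ.filter fun f : Fin n → G => ¬ Bad q e (⊤ : Submodule (ZMod p) G) ∅ f).card : ℝ) = g ^ n := by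
    rw [← hun]; exact_mod_cast Finset.card_filter_add_card_filter_not _
  calc _ = ((1 - n * g * Real.exp (-(e ^ 2 / 8 * n))) * g ^ n) * (g⁻¹ * L) ^ n := by
        rw [mul_pow, inv_pow]; field_simp
    _ ≤ (univ.filter fun f : Fin n → G => ¬ Bad q e (⊤ : Submodule (ZMod p) G) ∅ f).card *
        (g⁻¹ * L) ^ n := by
        refine mul_le_mul_of_nonneg_right ?_ (by positivity)
        linarith
    _ = ∑ f ∈ univ.filter fun f : Fin n → G => ¬ Bad q e (⊤ : Submodule (ZMod p) G) ∅ f,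
        (g⁻¹ * L) ^ n := by simp
    _ ≤ ∑ f ∈ univ.filter fun f : Fin n → G => ¬ Bad q e (⊤ : Submodule (ZMod p) G) ∅ f,
        Ptot q f := Finset.sum_le_sum fun f hf => hP f (mem_filter.1 hf).2
    _ ≤ _ := Finset.sum_le_sum_of_subset_of_nonneg
        (fun f hf => span_of_not_bad hn q e he f (mem_filter.1 hf).2) fun f _ _ => P_nonneg q h0 f

theorem colP_eq {n : ℕ} (q : Fin n → ZMod p → ℝ) (f : Fin n → G) :
    (X q f univ).coeff 0 = ∑ v : Fin n → ZMod p, (∏ k, q k (v k)) *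
      if ∑ k, v k • f k = 0 then 1 else 0 := by
  have : X q f univ = ∑ v : Fin n → ZMod p, AddMonoidAlgebra.single (∑ k, v k • f k) (∏ k, q k (v k)) := by
    rw [X]
    simp only [D]
    rw [Finset.prod_univ_sum, Fintype.piFinset_univ]
    refine Finset.sum_congr rfl fun v _ => ?_
    generalize (univ : Finset (Fin n)) = s
    induction s using Finset.induction_on with
    | empty => simp [AddMonoidAlgebra.one_def]
    | insert k s hk ih =>
      rw [Finset.prod_insert hk, Finset.prod_insert hk, Finset.sum_insert hk, ih,
        AddMonoidAlgebra.single_mul_single]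
  rw [this, AddMonoidAlgebra.coeff_sum, Finsupp.finsetSum_apply]
  refine Finset.sum_congr rfl fun v _ => ?_
  simp [AddMonoidAlgebra.coeff_single, Finsupp.single_apply]

theorem reduce {n : ℕ} (r : ℕ) (q : Fin n → Fin n → ZMod p → ℝ) :
    ∑ M : Matrix (Fin n) (Fin n) (ZMod p),
        (∏ k' : Fin n, ∏ l' : Fin n, q k' l' (M k' l')) *
          (Nat.card {F : (Fin n → ZMod p) →ₗ[ZMod p] (Fin r → ZMod p) //
            Function.Surjective F ∧ F.comp M.mulVecLin = 0} : ℝ) =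
      ∑ f ∈ Sp p (Fin r → ZMod p) n, Ptot q f := by
  have hcard : ∀ M : Matrix (Fin n) (Fin n) (ZMod p),
      (Nat.card {F : (Fin n → ZMod p) →ₗ[ZMod p] (Fin r → ZMod p) //
            Function.Surjective F ∧ F.comp M.mulVecLin = 0} : ℝ) =
      ∑ f ∈ Sp p (Fin r → ZMod p) n, ∏ l, if ∑ k, M k l • f k = 0 then (1 : ℝ) else 0 := by
    intro M
    have e : {f : Fin n → (Fin r → ZMod p) // f ∈ (Sp p (Fin r → ZMod p) n).filter
        (fun f => ∀ l, ∑ k, M k l • f k = 0)} ≃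
        {F : (Fin n → ZMod p) →ₗ[ZMod p] (Fin r → ZMod p) //
            Function.Surjective F ∧ F.comp M.mulVecLin = 0} := by
      refine Equiv.subtypeEquiv ((Pi.basisFun (ZMod p) (Fin n)).constr (ZMod p)).toEquiv ?_
      intro f
      have happ : ∀ v, (Pi.basisFun (ZMod p) (Fin n)).constr (ZMod p) f v = ∑ k, v k • f k := by
        intro v; rw [Module.Basis.constr_apply_fintype]; simp
      simp only [Sp, mem_filter, mem_univ, true_and, LinearEquiv.coe_toEquiv]
      refine and_congr ?_ ?_
      · rw [← LinearMap.range_eq_top, Module.Basis.constr_range]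
      · constructor
        · intro h
          refine (Pi.basisFun (ZMod p) (Fin n)).ext fun l => ?_
          simp only [LinearMap.comp_apply, LinearMap.zero_apply, happ, Pi.basisFun_apply,
            Matrix.mulVecLin_apply, Matrix.mulVec_single_one, Matrix.col_apply]
          exact h l
        · intro h l
          have := LinearMap.congr_fun h (Pi.single l 1)
          simpa only [LinearMap.comp_apply, LinearMap.zero_apply, happ, Pi.basisFun_apply,
            Matrix.mulVecLin_apply, Matrix.mulVec_single_one, Matrix.col_apply] using this
    rw [← Nat.card_congr e, Nat.card_eq_fintype_card, Fintype.card_coe, Finset.card_filter]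
    push_cast
    refine Finset.sum_congr rfl fun f _ => ?_
    rw [Finset.prod_ite_zero]
    simp
  simp only [hcard, Finset.mul_sum]
  rw [Finset.sum_comm]
  refine Finset.sum_congr rfl fun f _ => ?_
  simp only [Ptot, colP_eq]
  rw [Finset.prod_univ_sum, Fintype.piFinset_univ]
  refine Fintype.sum_equiv (Matrix.transposeAddEquiv (Fin n) (Fin n) (ZMod p)).toEquiv _ _ fun M => ?_
  rw [Finset.prod_comm, ← Finset.prod_mul_distrib]
  refine Finset.prod_congr rfl fun l _ => ?_
  refine congrArg₂ (· * ·) rfl ?_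
  by_cases h : ∑ k, M k l • f k = 0
  · rw [if_pos h]
    exact (if_pos h).symm
  · rw [if_neg h]
    exact (if_neg h).symm

end CokMoment
end Aux
set_option linter.unusedSectionVars false
set_option linter.unusedVariables false

section Aux
open Finset
open scoped Classical

namespace CokMoment

theorem mw_small {α e : ℝ} (hα0 : 0 < α) (hα : α ≤ 1 / 2) (w : ℕ) (h : α * w ≤ 2 * e) :
    (1 + (1 - 2 * α) ^ w) / 2 ≤ Real.exp (-(α * w * (1 - e))) := by
  have h1 : (1 - 2 * α) ^ w ≤ Real.exp (-(2 * (α * w))) := by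
    have : 1 - 2 * α ≤ Real.exp (-(2 * α)) := by
      have := Real.add_one_le_exp (-(2 * α)); linarith
    calc (1 - 2 * α) ^ w ≤ (Real.exp (-(2 * α))) ^ w := pow_le_pow_left₀ (by linarith) this _
      _ = _ := by rw [← Real.exp_nat_mul]; congr 1; ring
  set t := α * w with ht
  have ht0 : 0 ≤ t := by positivity
  have h2 : (1 + Real.exp (-(2 * t))) / 2 = Real.exp (-t) * Real.cosh t := by
    rw [Real.cosh_eq, mul_div_assoc', mul_add, ← Real.exp_add, ← Real.exp_add]
    congr 2
    · simp
    · congr 1; ring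
  calc (1 + (1 - 2 * α) ^ w) / 2 ≤ (1 + Real.exp (-(2 * t))) / 2 := by linarith
    _ = Real.exp (-t) * Real.cosh t := h2
    _ ≤ Real.exp (-t) * Real.exp (t ^ 2 / 2) :=
        mul_le_mul_of_nonneg_left (Real.cosh_le_exp_half_sq t) (Real.exp_pos _).le
    _ = Real.exp (-t + t ^ 2 / 2) := by rw [Real.exp_add]
    _ ≤ _ := by
        apply Real.exp_le_exp.2
        nlinarith

theorem mw_large {α e : ℝ} (hα0 : 0 < α) (hα : α ≤ 1 / 2) (w : ℕ) (h : 2 * e ≤ α * w) :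
    (1 + (1 - 2 * α) ^ w) / 2 ≤ (1 + Real.exp (-(4 * e))) / 2 := by
  have h1 : (1 - 2 * α) ^ w ≤ Real.exp (-(2 * (α * w))) := by
    have : 1 - 2 * α ≤ Real.exp (-(2 * α)) := by
      have := Real.add_one_le_exp (-(2 * α)); linarith
    calc (1 - 2 * α) ^ w ≤ (Real.exp (-(2 * α))) ^ w := pow_le_pow_left₀ (by linarith) this _
      _ = _ := by rw [← Real.exp_nat_mul]; congr 1; ring
  have h2 : Real.exp (-(2 * (α * w))) ≤ Real.exp (-(4 * e)) := Real.exp_le_exp.2 (by linarith)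
  linarith

theorem Zs_nonneg {g α δ : ℝ} (hg : 0 ≤ g) (hα : α ≤ 1 / 2) (n : ℕ) : 0 ≤ Zs g α δ n := by
  refine Finset.sum_nonneg fun T _ => ?_
  have : 0 ≤ (1 - 2 * α) ^ T.card := pow_nonneg (by linarith) _
  positivity

theorem Zs_le {g α δ e x : ℝ} (hg : 0 ≤ g) (hα0 : 0 < α) (hα : α ≤ 1 / 2) (he : 0 < e)
    (hx : 0 < x) (hx1 : x ≤ 1) (n : ℕ) :
    Zs g α δ n ≤ ((1 + g * Real.exp (-(α * n * (1 - e)))) ^ n - 1) +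
      (((1 + Real.exp (-(4 * e))) / 2) * x ^ (-δ) * (1 + g * x)) ^ n := by
  set ρ := (1 + Real.exp (-(4 * e))) / 2 with hρ
  have hρ0 : 0 ≤ ρ := by positivity
  set u := g * Real.exp (-(α * n * (1 - e))) with hu
  have hu0 : 0 ≤ u := by positivity
  have hX : 0 ≤ x ^ (-δ) := by positivity
  have hterm : ∀ T : Finset (Fin n), (T.card : ℝ) ≤ δ * n →
      ((1 + (1 - 2 * α) ^ T.card) / 2) ^ n * g ^ T.card ≤
        u ^ T.card + (ρ * x ^ (-δ)) ^ n * (g * x) ^ T.card := by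
    intro T hT
    have hm0 : 0 ≤ (1 + (1 - 2 * α) ^ T.card) / 2 := by
      have : 0 ≤ (1 - 2 * α) ^ T.card := pow_nonneg (by linarith) _
      positivity
    rcases le_total (α * T.card) (2 * e) with h | h
    · have h1 := pow_le_pow_left₀ hm0 (mw_small hα0 hα T.card h) n
      have h2 : (Real.exp (-(α * T.card * (1 - e)))) ^ n * g ^ T.card = u ^ T.card := by
        rw [hu, mul_pow, ← Real.exp_nat_mul, ← Real.exp_nat_mul, mul_comm]
        congr 2; ring
      have h3 := mul_le_mul_of_nonneg_right h1 (pow_nonneg hg T.card)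
      have h4 : 0 ≤ (ρ * x ^ (-δ)) ^ n * (g * x) ^ T.card := by positivity
      linarith
    · have h1 := pow_le_pow_left₀ hm0 (mw_large hα0 hα T.card h) n
      have h3 := mul_le_mul_of_nonneg_right h1 (pow_nonneg hg T.card)
      have h5 : 1 ≤ (x ^ (-δ)) ^ n * x ^ T.card := by
        rw [← Real.rpow_natCast (x ^ (-δ)), ← Real.rpow_mul hx.le, ← Real.rpow_natCast x T.card,
          ← Real.rpow_add hx]
        exact Real.one_le_rpow_of_pos_of_le_one_of_nonpos hx hx1 (by linarith)
      have h4 : 0 ≤ u ^ T.card := by positivity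
      have h6 : ρ ^ n * g ^ T.card ≤ (ρ * x ^ (-δ)) ^ n * (g * x) ^ T.card := by
        have h7 : 0 ≤ ρ ^ n * g ^ T.card := by positivity
        calc ρ ^ n * g ^ T.card ≤ ρ ^ n * g ^ T.card * ((x ^ (-δ)) ^ n * x ^ T.card) :=
              le_mul_of_one_le_right h7 h5
          _ = _ := by rw [mul_pow, mul_pow]; ring
      linarith
  have hsum : ∀ a : ℝ, ∑ T : Finset (Fin n), a ^ T.card = (1 + a) ^ n := by
    intro a
    have := Fintype.sum_pow_mul_eq_add_pow (Fin n) a 1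
    simpa [add_comm] using this
  have hsplit : ∑ T ∈ univ.filter (fun T : Finset (Fin n) => T ≠ ∅), u ^ T.card = (1 + u) ^ n - 1 := by
    have := Finset.sum_erase_add (univ : Finset (Finset (Fin n))) (fun T => u ^ T.card) (mem_univ ∅)
    rw [hsum] at this
    rw [Finset.filter_ne']
    simp only [Finset.card_empty, pow_zero] at this
    linarith
  calc Zs g α δ n ≤ ∑ T ∈ univ.filter (fun T : Finset (Fin n) => T ≠ ∅ ∧ (T.card : ℝ) ≤ δ * n),
        (u ^ T.card + (ρ * x ^ (-δ)) ^ n * (g * x) ^ T.card) :=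
        Finset.sum_le_sum fun T hT => hterm T (mem_filter.1 hT).2.2
    _ = ∑ T ∈ univ.filter (fun T : Finset (Fin n) => T ≠ ∅ ∧ (T.card : ℝ) ≤ δ * n), u ^ T.card +
        ∑ T ∈ univ.filter (fun T : Finset (Fin n) => T ≠ ∅ ∧ (T.card : ℝ) ≤ δ * n),
          (ρ * x ^ (-δ)) ^ n * (g * x) ^ T.card := Finset.sum_add_distrib
    _ ≤ ∑ T ∈ univ.filter (fun T : Finset (Fin n) => T ≠ ∅), u ^ T.card +
        ∑ T : Finset (Fin n), (ρ * x ^ (-δ)) ^ n * (g * x) ^ T.card := by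
        refine add_le_add ?_ ?_
        · refine Finset.sum_le_sum_of_subset_of_nonneg ?_ fun T _ _ => by positivity
          intro T hT
          exact mem_filter.2 ⟨mem_univ _, (mem_filter.1 hT).2.1⟩
        · exact Finset.sum_le_sum_of_subset_of_nonneg (subset_univ _) fun T _ _ => by positivity
    _ = _ := by rw [hsplit, ← Finset.mul_sum, hsum, ← mul_pow]

theorem one_add_pow_le {u : ℝ} (hu : 0 ≤ u) (n : ℕ) : (1 + u) ^ n ≤ Real.exp (n * u) := by
  rw [Real.exp_nat_mul]
  refine pow_le_pow_left₀ (by linarith) ?_ n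
  have := Real.add_one_le_exp u; linarith

theorem tendsto_log_cast : Filter.Tendsto (fun n : ℕ => Real.log n) Filter.atTop Filter.atTop :=
  Real.tendsto_log_atTop.comp tendsto_natCast_atTop_atTop

theorem tendsto_exp_log {a : ℝ} (ha : 0 < a) :
    Filter.Tendsto (fun n : ℕ => Real.exp (-(a * Real.log n))) Filter.atTop (nhds 0) :=
  Real.tendsto_exp_neg_atTop_nhds_zero.comp (tendsto_log_cast.const_mul_atTop ha)

theorem tendsto_nexp {a : ℝ} (ha : 0 < a) (g : ℝ) :
    Filter.Tendsto (fun n : ℕ => (n : ℝ) * g * Real.exp (-(a * n))) Filter.atTop (nhds 0) := by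
  have h := (Real.tendsto_pow_mul_exp_neg_atTop_nhds_zero 1).comp
    ((tendsto_natCast_atTop_atTop (R := ℝ)).const_mul_atTop ha)
  have h2 := h.const_mul (g / a)
  simp only [mul_zero] at h2
  refine h2.congr fun n => ?_
  simp only [Function.comp, pow_one]
  field_simp

theorem consts {c g : ℝ} (hc : 1 < c) (hg : 0 < g) :
    ∃ e δ x : ℝ, 0 < e ∧ e ≤ 1 / 2 ∧ 1 < c * (1 - e) ^ 3 ∧ 0 < δ ∧ δ ≤ e ∧ 0 < x ∧ x ≤ 1 ∧
      ((1 + Real.exp (-(4 * e))) / 2) * x ^ (-δ) * (1 + g * x) < 1 := by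
  have h1 : ∃ e : ℝ, 0 < e ∧ e ≤ 1 / 2 ∧ 1 < c * (1 - e) ^ 3 := by
    have ht : Filter.Tendsto (fun e : ℝ => c * (1 - e) ^ 3) (nhdsWithin 0 (Set.Ioi 0)) (nhds (c * (1 - 0) ^ 3)) :=
      (Continuous.tendsto (by fun_prop) 0).mono_left nhdsWithin_le_nhds
    have hev := ht.eventually_const_lt (u := 1) (by simpa using hc)
    have hm : ∀ᶠ e : ℝ in nhdsWithin 0 (Set.Ioi 0), e ∈ Set.Ioc (0:ℝ) (1/2) :=
      Ioc_mem_nhdsGT (by norm_num)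
    obtain ⟨e, h, h'⟩ := (hev.and hm).exists
    exact ⟨e, h'.1, h'.2, h⟩
  obtain ⟨e, he0, he, hce⟩ := h1
  set ρ := (1 + Real.exp (-(4 * e))) / 2 with hρ
  have hρ1 : ρ < 1 := by
    have : Real.exp (-(4 * e)) < 1 := by
      rw [← Real.exp_zero]; exact Real.exp_lt_exp.2 (by linarith)
    rw [hρ]; linarith
  have h2 : ∃ x : ℝ, 0 < x ∧ x ≤ 1 ∧ ρ * (1 + g * x) < 1 := by
    have ht : Filter.Tendsto (fun x : ℝ => ρ * (1 + g * x)) (nhdsWithin 0 (Set.Ioi 0)) (nhds (ρ * (1 + g * 0))) :=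
      (Continuous.tendsto (by fun_prop) 0).mono_left nhdsWithin_le_nhds
    have hev := ht.eventually_lt_const (u := 1) (by simpa using hρ1)
    have hm : ∀ᶠ x : ℝ in nhdsWithin 0 (Set.Ioi 0), x ∈ Set.Ioc (0:ℝ) 1 :=
      Ioc_mem_nhdsGT (by norm_num)
    obtain ⟨x, h, h'⟩ := (hev.and hm).exists
    exact ⟨x, h'.1, h'.2, h⟩
  obtain ⟨x, hx0, hx1, hx⟩ := h2
  have h3 : ∃ δ : ℝ, 0 < δ ∧ δ ≤ e ∧ ρ * x ^ (-δ) * (1 + g * x) < 1 := by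
    have hcont : Continuous fun δ : ℝ => ρ * x ^ (-δ) * (1 + g * x) := by
      have : Continuous fun δ : ℝ => x ^ (-δ) := (Real.continuous_const_rpow hx0.ne').comp continuous_neg
      fun_prop
    have ht : Filter.Tendsto (fun δ : ℝ => ρ * x ^ (-δ) * (1 + g * x)) (nhdsWithin 0 (Set.Ioi 0))
        (nhds (ρ * x ^ (-(0:ℝ)) * (1 + g * x))) :=
      (hcont.tendsto 0).mono_left nhdsWithin_le_nhds
    have hev := ht.eventually_lt_const (u := 1) (by simpa using hx)
    have hm : ∀ᶠ δ : ℝ in nhdsWithin 0 (Set.Ioi 0), δ ∈ Set.Ioc (0:ℝ) e :=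
      Ioc_mem_nhdsGT he0
    obtain ⟨δ, h, h'⟩ := (hev.and hm).exists
    exact ⟨δ, h'.1, h'.2, h⟩
  obtain ⟨δ, hδ0, hδ, hh⟩ := h3
  exact ⟨e, δ, x, he0, he, hce, hδ0, hδ, hx0, hx1, hh⟩

set_option maxHeartbeats 2000000 in
theorem ana {c g γ : ℝ} (hc : 1 < c) (hg : 0 < g) (hγ : 0 < γ) :
    ∃ e θ : ℝ, 0 < e ∧ e < 1 ∧ 0 < θ ∧ ∃ U V W : ℕ → ℝ,
      Filter.Tendsto U Filter.atTop (nhds 1) ∧ Filter.Tendsto V Filter.atTop (nhds 0) ∧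
      Filter.Tendsto W Filter.atTop (nhds 1) ∧
      ∀ᶠ n : ℕ in Filter.atTop, 0 < c * Real.log n / n ∧ c * Real.log n / n ≤ 1 / 2 ∧
        Rs g (c * Real.log n / n) (θ * g) e (γ * θ) n ≤ U n ∧
        Zs g (c * Real.log n / n) (θ * g) n ≤ V n ∧
        0 ≤ 1 - g * Real.exp (-(c * Real.log n / n * (1 - c * Real.log n / n) * ((1 - e) * n))) ∧
        W n ≤ (1 - n * g * Real.exp (-(e ^ 2 / 8 * n))) *
          (1 - g * Real.exp (-(c * Real.log n / n * (1 - c * Real.log n / n) * ((1 - e) * n)))) ^ n := by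
  obtain ⟨e, δ, x, he0, he, hce, hδ0, hδ, hx0, hx1, hlt⟩ := consts hc hg
  set c' := c * (1 - e) ^ 3 with hc'
  set K := (1 + Real.exp (-(4 * e))) / 2 * x ^ (-δ) * (1 + g * x) with hK
  have hK0 : 0 ≤ K := by positivity
  set η := γ * (δ / g) with hη
  have hη0 : 0 < η := by positivity
  let y : ℕ → ℝ := fun n => n * (g * Real.exp (-(c' * Real.log n)))
  have hy : Filter.Tendsto y Filter.atTop (nhds 0) := by
    have h := (tendsto_exp_log (a := c' - 1) (by linarith)).const_mul g
    rw [mul_zero] at h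
    refine h.congr' ?_
    filter_upwards [Filter.eventually_gt_atTop 0] with n hn
    have hn' : (0:ℝ) < n := by exact_mod_cast hn
    have : Real.exp (-((c' - 1) * Real.log n)) = n * Real.exp (-(c' * Real.log n)) := by
      conv_rhs => rw [← Real.exp_log hn']
      rw [← Real.exp_add, Real.log_exp]; congr 1; ring
    simp only [y]; rw [this]; ring
  have hexpy : Filter.Tendsto (fun n => Real.exp (y n)) Filter.atTop (nhds 1) := by
    have := (Real.continuous_exp.tendsto 0).comp hy
    simpa [Function.comp_def] using this
  have hα : Filter.Tendsto (fun n : ℕ => c * Real.log n / n) Filter.atTop (nhds 0) := by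
    have h : Filter.Tendsto (fun x : ℝ => Real.log x / x) Filter.atTop (nhds 0) := by
      simpa using Real.isLittleO_log_id_atTop.tendsto_div_nhds_zero
    have h2 := (h.comp (tendsto_natCast_atTop_atTop (R := ℝ))).const_mul c
    rw [mul_zero] at h2
    refine h2.congr fun n => ?_
    simp only [Function.comp]; ring
  have hsm := (tendsto_exp_log (a := c * η / 2) (by positivity)).const_mul g
  rw [mul_zero] at hsm
  refine ⟨e, δ / g, he0, by linarith, by positivity,
    fun n => Real.exp (y n) + n * g * Real.exp (-(e ^ 2 / 32 * n)),
    fun n => (Real.exp (y n) - 1) + K ^ n,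
    fun n => (1 - n * g * Real.exp (-(e ^ 2 / 8 * n))) * (1 - y n), ?_, ?_, ?_, ?_⟩
  · simpa using hexpy.add (tendsto_nexp (a := e ^ 2 / 32) (by positivity) g)
  · simpa using (hexpy.sub_const 1).add (tendsto_pow_atTop_nhds_zero_of_lt_one hK0 hlt)
  · have h1 := (tendsto_nexp (a := e ^ 2 / 8) (by positivity) g).const_sub 1
    have h2 := hy.const_sub 1
    simpa using h1.mul h2
  have hδg : δ / g * g = δ := by field_simp
  rw [hδg]
  filter_upwards [Filter.eventually_ge_atTop 2, hα.eventually_le_const he0,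
    hsm.eventually_le_const (show (0:ℝ) < e ^ 2 / 32 by positivity),
    hy.eventually_le_const (show (0:ℝ) < 1 by norm_num),
    (tendsto_nexp (a := e ^ 2 / 8) (by positivity) g).eventually_le_const (show (0:ℝ) < 1 by norm_num)]
    with n hn hαe hs hyn hne
  have hn2 : (2:ℝ) ≤ n := by exact_mod_cast hn
  have hlog : 0 < Real.log n := Real.log_pos (by linarith)
  have hαn : c * Real.log n / n * n = c * Real.log n := by field_simp
  have hα0 : 0 < c * Real.log n / n := by positivity
  set α := c * Real.log n / n with hαdef
  have hcl : 0 < c * Real.log n := by positivity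
  have h1e : 0 ≤ 1 - e := by linarith
  have hc'l : c' * Real.log n = c * Real.log n * (1 - e) ^ 3 := by rw [hc']; ring
  have hpe : (1 - e) ^ 2 ≤ 1 - e := by nlinarith
  have hpe3 : (1 - e) ^ 3 ≤ (1 - e) ^ 2 := by nlinarith [mul_nonneg h1e h1e]
  -- three exponent comparisons
  have hE1 : c' * Real.log n ≤ α * (1 - α) * ((1 - e) * ((1 - δ) * n)) := by
    have : α * (1 - α) * ((1 - e) * ((1 - δ) * n)) = (α * n) * ((1 - α) * (1 - e) * (1 - δ)) := by ring
    rw [this, hαn, hc'l]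
    refine mul_le_mul_of_nonneg_left ?_ hcl.le
    calc (1 - e) ^ 3 = (1 - e) * (1 - e) * (1 - e) := by ring
      _ ≤ (1 - α) * (1 - e) * (1 - δ) := by
        have a1 : 1 - e ≤ 1 - α := by linarith
        have a2 : 1 - e ≤ 1 - δ := by linarith
        have a3 : 0 ≤ 1 - α := by linarith
        gcongr
  have hE2 : c' * Real.log n ≤ α * (1 - α) * ((1 - e) * n) := by
    have : α * (1 - α) * ((1 - e) * n) = (α * n) * ((1 - α) * (1 - e)) := by ring
    rw [this, hαn, hc'l]
    refine mul_le_mul_of_nonneg_left ?_ hcl.le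
    have : (1 - e) * (1 - e) ≤ (1 - α) * (1 - e) := mul_le_mul_of_nonneg_right (by linarith) h1e
    nlinarith
  have hE3 : c' * Real.log n ≤ α * n * (1 - e) := by
    rw [hαn, hc'l]
    exact mul_le_mul_of_nonneg_left (by linarith) hcl.le
  have hE4 : c * η / 2 * Real.log n ≤ α * (1 - α) * (η * n) := by
    have : α * (1 - α) * (η * n) = (α * n) * ((1 - α) * η) := by ring
    rw [this, hαn]
    have h5 : 1 / 2 * η ≤ (1 - α) * η := mul_le_mul_of_nonneg_right (by linarith) hη0.le
    have := mul_le_mul_of_nonneg_left h5 hcl.le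
    linarith
  have hmono : ∀ a b : ℝ, a ≤ b → g * Real.exp (-b) ≤ g * Real.exp (-a) := fun a b h =>
    mul_le_mul_of_nonneg_left (Real.exp_le_exp.2 (by linarith)) hg.le
  have hpw : ∀ b : ℝ, c' * Real.log n ≤ b → (1 + g * Real.exp (-b)) ^ n ≤ Real.exp (y n) := by
    intro b hb
    refine (one_add_pow_le (by positivity) n).trans (Real.exp_le_exp.2 ?_)
    exact mul_le_mul_of_nonneg_left (hmono _ _ hb) (by positivity)
  have hny : ∀ b : ℝ, c' * Real.log n ≤ b → n * (g * Real.exp (-b)) ≤ y n := fun b hb =>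
    mul_le_mul_of_nonneg_left (hmono _ _ hb) (by positivity)
  have h7 := hny _ hE2
  have h8 : 0 ≤ g * Real.exp (-(α * (1 - α) * ((1 - e) * n))) := by positivity
  refine ⟨hα0, by linarith, ?_, ?_, ?_⟩
  · rw [Rs]
    refine add_le_add (hpw _ hE1) ?_
    have h6 : (1 + g * Real.exp (-(α * (1 - α) * (η * n)))) ^ n ≤ Real.exp (n * (e ^ 2 / 32)) :=
      (one_add_pow_le (by positivity) n).trans
        (Real.exp_le_exp.2 (mul_le_mul_of_nonneg_left ((hmono _ _ hE4).trans hs) (by positivity)))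
    calc _ ≤ n * g * Real.exp (-(e ^ 2 / 8 * ((1 - δ) * n))) * Real.exp (n * (e ^ 2 / 32)) :=
          mul_le_mul_of_nonneg_left h6 (by positivity)
      _ = n * g * Real.exp (-(e ^ 2 / 8 * ((1 - δ) * n)) + n * (e ^ 2 / 32)) := by
          rw [Real.exp_add]; ring
      _ ≤ _ := by
          refine mul_le_mul_of_nonneg_left (Real.exp_le_exp.2 ?_) (by positivity)
          have h8 : 0 ≤ e ^ 2 * n := by positivity
          have h9 : e ^ 2 * n * (1 / 2) ≤ e ^ 2 * n * (1 - δ) := mul_le_mul_of_nonneg_left (by linarith) h8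
          nlinarith
  · refine (Zs_le (δ := δ) hg.le hα0 (by linarith) he0 hx0 hx1 n).trans ?_
    have := hpw _ hE3
    linarith
  generalize g * Real.exp (-(α * (1 - α) * ((1 - e) * n))) = u at h7 h8 ⊢
  have hu1 : u ≤ 1 := by
    have h9 : u ≤ n * u := le_mul_of_one_le_left h8 (by linarith only [hn2])
    exact h9.trans (h7.trans hyn)
  constructor
  · linarith only [hu1]
  · refine mul_le_mul_of_nonneg_left ?_ (by linarith only [hne])
    have := one_add_mul_le_pow (a := -u) (by linarith only [hu1]) n
    rw [← sub_eq_add_neg] at this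
    linarith only [this, h7]

end CokMoment
end Aux

theorem stmt_3 (p : ℕ) [Fact p.Prime] (r : ℕ) (c : ℝ) (hc : 1 < c)
    (q : (n : ℕ) → Fin n → Fin n → ZMod p → ℝ)
    (hq0 : ∀ n k' l' a, 0 ≤ q n k' l' a)
    (hq1 : ∀ n k' l', ∑ a : ZMod p, q n k' l' a = 1)
    (hbal : ∀ n, 2 ≤ n → ∀ k' l' (a : ZMod p), q n k' l' a ≤ 1 - c * Real.log n / n) :
    Filter.Tendsto (fun n : ℕ =>
      ∑ M : Matrix (Fin n) (Fin n) (ZMod p),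
        (∏ k' : Fin n, ∏ l' : Fin n, q n k' l' (M k' l')) *
          (Nat.card {F : (Fin n → ZMod p) →ₗ[ZMod p] (Fin r → ZMod p) //
            Function.Surjective F ∧ F.comp M.mulVecLin = 0} : ℝ))
      Filter.atTop (nhds 1) := by
  classical
  obtain ⟨γ, hγ0, hγ⟩ := CokMoment.exists_gamma (Fin r → ZMod p)
  have hg : (0:ℝ) < (Fintype.card (Fin r → ZMod p) : ℝ) := Nat.cast_pos.2 Fintype.card_pos
  obtain ⟨e, θ, he0, he1, hθ, U, V, W, hU, hV, hW, hev⟩ := CokMoment.ana hc hg hγ0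
  have hup : Filter.Tendsto
      (fun n => U n * (1 + (Fintype.card (Submodule (ZMod p) (Fin r → ZMod p)) : ℝ) * V n))
      Filter.atTop (nhds 1) := by
    simpa using hU.mul ((hV.const_mul
      (Fintype.card (Submodule (ZMod p) (Fin r → ZMod p)) : ℝ)).const_add 1)
  refine tendsto_of_tendsto_of_tendsto_of_le_of_le' hW hup ?_ ?_
  · filter_upwards [hev, Filter.eventually_ge_atTop 2] with n h hn
    obtain ⟨hα0, hα, -, -, hpos, hWn⟩ := h
    rw [CokMoment.reduce]
    refine hWn.trans ?_
    exact CokMoment.lower (by omega) (q n) (hq0 n) (hq1 n) _ hα0 hα (hbal n hn) e he0.le he1 hpos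
  · filter_upwards [hev, Filter.eventually_ge_atTop 2] with n h hn
    obtain ⟨hα0, hα, hR, hZ, -, -⟩ := h
    rw [CokMoment.reduce]
    refine (CokMoment.upper (q n) (hq0 n) (hq1 n) _ hα0 hα (hbal n hn) e he0.le he1.le θ γ hθ.le
      hγ0 hγ).trans ?_
    have hZ0 := CokMoment.Zs_nonneg (δ := θ * Fintype.card (Fin r → ZMod p)) hg.le hα n
    refine mul_le_mul hR ?_ (by positivity) (le_trans (by unfold CokMoment.Rs; positivity) hR)
    gcongr
end

section
/- lim_{n→∞} [ 1 − (1 − (1 − (log n)/n)^n)^n ] = 1 − e^{−1}. (Consequently, for a random n×n matrix over F_p whose entries are i.i.d. with P(entry = 0) = 1 − (log n)/n, the probability that the matrix has at least one zero column converges to 1 − e^{−1}, so universality of cokernels fails at balance parameter (log n)/n.) -/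
open Filter Topology in
lemma aux_lim :
    Tendsto (fun n : ℕ => (n : ℝ) * (1 - Real.log n / n) ^ n) atTop (𝓝 1) := by
  have h0 : Tendsto (fun n : ℕ => 1 - Real.log n ^ 2 / (1 * (n : ℝ) + 0)) atTop (𝓝 (1 - 0)) :=
    ((Real.tendsto_pow_log_div_mul_add_atTop 1 0 2 one_ne_zero).comp
      tendsto_natCast_atTop_atTop).const_sub 1
  rw [sub_zero] at h0
  have key : ∀ n : ℕ, 1 ≤ n → 0 ≤ Real.log n / n ∧ Real.log n / n ≤ 1 ∧
      (n : ℝ) * (1 - Real.log n / n) ^ n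
        = ((1 - Real.log n / n) * Real.exp (Real.log n / n)) ^ n := by
    intro n hn
    have hn' : (0 : ℝ) < n := by exact_mod_cast hn
    refine ⟨div_nonneg (Real.log_natCast_nonneg n) hn'.le, ?_, ?_⟩
    · rw [div_le_one hn']
      linarith [Real.log_le_sub_one_of_pos hn']
    · rw [mul_pow, ← Real.exp_nat_mul, mul_div_cancel₀ _ hn'.ne', Real.exp_log hn', mul_comm]
  refine tendsto_of_tendsto_of_tendsto_of_le_of_le' h0 tendsto_const_nhds ?_ ?_
  · filter_upwards [eventually_ge_atTop 1] with n hn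
    obtain ⟨hx0, hx1, h⟩ := key n hn
    have hn' : (0 : ℝ) < n := by exact_mod_cast hn
    rw [h]
    have e : 1 - Real.log n ^ 2 / (1 * (n : ℝ) + 0)
        = 1 + (n : ℝ) * (-(Real.log n / n) ^ 2) := by
      field_simp
      ring
    rw [e]
    set x := Real.log n / n
    have hx2 : x ^ 2 ≤ 1 := pow_le_one₀ hx0 hx1
    refine (one_add_mul_le_pow (by linarith) n).trans ?_
    apply pow_le_pow_left₀ (by linarith)
    nlinarith [Real.add_one_le_exp x]
  · filter_upwards [eventually_ge_atTop 1] with n hn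
    obtain ⟨hx0, hx1, h⟩ := key n hn
    rw [h]
    set x := Real.log n / n
    apply pow_le_one₀ (mul_nonneg (by linarith) (Real.exp_pos x).le)
    calc (1 - x) * Real.exp x ≤ Real.exp (-x) * Real.exp x := by
          gcongr
          linarith [Real.add_one_le_exp (-x)]
      _ = 1 := by rw [← Real.exp_add]; simp

/-- `lim_{n→∞} [ 1 − (1 − (1 − (log n)/n)^n)^n ] = 1 − e^{−1}`, where `log` is the natural
logarithm and the limit is over integers `n → ∞`. -/
theorem stmt_4 :
    Filter.Tendsto (fun n : ℕ => 1 - (1 - (1 - Real.log n / n) ^ n) ^ n)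
      Filter.atTop (nhds (1 - Real.exp (-1))) := by
  apply Filter.Tendsto.const_sub
  have h := Real.tendsto_one_add_pow_exp_of_tendsto
    (g := fun n : ℕ => -(1 - Real.log n / n) ^ n) (t := -1)
    (by simpa only [mul_neg] using aux_lim.neg)
  simpa only [← sub_eq_add_neg] using h
end

section
/- Let p be a prime and r a positive integer. Let A and B be nonempty subsets of F_p^r∖{0} such that g·h = 0 for every g ∈ A and every h ∈ B, and (|A|+1)·(|B|+1) ≥ p^r. Then there exists an F_p-subspace V of F_p^r, with V neither the zero subspace nor all of F_p^r, such that A = V∖{0} and B = V^⊥∖{0}, where V^⊥ = {h ∈ F_p^r : g·h = 0 for all g ∈ V}. -/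
/-- Let `p` be a prime and `r` a positive integer. Let `A, B` be nonempty subsets of
`F_p^r ∖ {0}` such that `g·h = 0` for all `g ∈ A`, `h ∈ B`, and
`(|A|+1)(|B|+1) ≥ p^r`. Then there is an `F_p`-subspace `V` of `F_p^r`, neither zero
nor the whole space, with `A = V∖{0}` and `B = V^⊥∖{0}`, where
`V^⊥ = {h : g·h = 0 for all g ∈ V}`. -/
theorem stmt_11 (p : ℕ) [Fact p.Prime] (r : ℕ) (hr : 0 < r)
    (A B : Finset (Fin r → ZMod p)) (hA : A.Nonempty) (hB : B.Nonempty)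
    (hA0 : (0 : Fin r → ZMod p) ∉ A) (hB0 : (0 : Fin r → ZMod p) ∉ B)
    (horth : ∀ g ∈ A, ∀ h ∈ B, (∑ j, g j * h j) = 0)
    (hcard : p ^ r ≤ (A.card + 1) * (B.card + 1)) :
    ∃ V : Submodule (ZMod p) (Fin r → ZMod p), V ≠ ⊥ ∧ V ≠ ⊤ ∧
      (A : Set (Fin r → ZMod p)) = (V : Set (Fin r → ZMod p)) \ {0} ∧
      (B : Set (Fin r → ZMod p)) = {h | ∀ g ∈ V, (∑ j, g j * h j) = 0} \ {0} := by
  classical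
  set V : Submodule (ZMod p) (Fin r → ZMod p) :=
    Submodule.span (ZMod p) (A : Set (Fin r → ZMod p)) with hV
  set W : Submodule (ZMod p) (Fin r → ZMod p) :=
    V.dualAnnihilator.map (dotProductEquiv (ZMod p) (Fin r)).symm.toLinearMap with hW
  have memW : ∀ h, h ∈ W ↔ ∀ g ∈ V, (∑ j, g j * h j) = 0 := by
    intro h
    have h1 : h ∈ W ↔ dotProductEquiv (ZMod p) (Fin r) h ∈ V.dualAnnihilator := by
      rw [hW, Submodule.mem_map]
      constructor
      · rintro ⟨y, hy, rfl⟩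
        simpa using hy
      · intro hy
        exact ⟨_, hy, by simp⟩
    rw [h1, Submodule.mem_dualAnnihilator]
    refine forall₂_congr fun g _ => ?_
    simp [dotProduct, mul_comm]
  have hAV : insert 0 A ⊆ (V : Set (Fin r → ZMod p)).toFinset := by
    intro x hx
    rw [Set.mem_toFinset]
    rcases Finset.mem_insert.1 hx with rfl | hx
    · exact V.zero_mem
    · exact Submodule.subset_span hx
  have hBW : insert 0 B ⊆ (W : Set (Fin r → ZMod p)).toFinset := by
    intro x hx
    rw [Set.mem_toFinset]
    rcases Finset.mem_insert.1 hx with rfl | hx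
    · exact W.zero_mem
    · refine (memW x).2 fun g hg => ?_
      induction hg using Submodule.span_induction with
      | mem g hg => exact horth g hg x hx
      | zero => simp
      | add a b _ _ ha hb => simp [add_mul, Finset.sum_add_distrib, ha, hb]
      | smul c a _ ha => simp [mul_assoc, ← Finset.mul_sum, ha]
  have hfr : Module.finrank (ZMod p) V + Module.finrank (ZMod p) W = r := by
    have h1 := Subspace.finrank_add_finrank_dualAnnihilator_eq V
    have h2 : Module.finrank (ZMod p) W = Module.finrank (ZMod p) V.dualAnnihilator :=
      LinearEquiv.finrank_map_eq _ _
    rw [h2, h1]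
    simp
  have cV : (V : Set (Fin r → ZMod p)).toFinset.card = p ^ Module.finrank (ZMod p) V := by
    rw [Set.toFinset_card]
    have := Module.card_eq_pow_finrank (K := ZMod p) (V := V)
    rw [ZMod.card] at this
    convert! this
  have cW : (W : Set (Fin r → ZMod p)).toFinset.card = p ^ Module.finrank (ZMod p) W := by
    rw [Set.toFinset_card]
    have := Module.card_eq_pow_finrank (K := ZMod p) (V := W)
    rw [ZMod.card] at this
    convert! this
  have lA := Finset.card_le_card hAV
  have lB := Finset.card_le_card hBW
  have eA : (insert 0 A).card = A.card + 1 := Finset.card_insert_of_notMem hA0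
  have eB : (insert 0 B).card = B.card + 1 := Finset.card_insert_of_notMem hB0
  have hpr : p ^ r = (V : Set (Fin r → ZMod p)).toFinset.card *
      (W : Set (Fin r → ZMod p)).toFinset.card := by
    rw [cV, cW, ← pow_add]
    exact congrArg (fun n => p ^ n) hfr.symm
  rw [hpr, ← eA, ← eB] at hcard
  have pA : 0 < (insert 0 A).card := by omega
  have pB : 0 < (insert 0 B).card := by omega
  have qA : insert 0 A = (V : Set (Fin r → ZMod p)).toFinset :=
    Finset.eq_of_subset_of_card_le hAV (by by_contra! hlt; nlinarith)
  have qB : insert 0 B = (W : Set (Fin r → ZMod p)).toFinset :=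
    Finset.eq_of_subset_of_card_le hBW (by by_contra! hlt; nlinarith)
  have mA : ∀ x, x ∈ V ↔ x = 0 ∨ x ∈ A := by
    intro x
    rw [← Finset.mem_insert, qA, Set.mem_toFinset, SetLike.mem_coe]
  have mB : ∀ x, x ∈ W ↔ x = 0 ∨ x ∈ B := by
    intro x
    rw [← Finset.mem_insert, qB, Set.mem_toFinset, SetLike.mem_coe]
  refine ⟨V, ?_, ?_, ?_, ?_⟩
  · intro h
    obtain ⟨a, ha⟩ := hA
    have h1 := (mA a).2 (Or.inr ha)
    rw [h, Submodule.mem_bot] at h1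
    exact hA0 (h1 ▸ ha)
  · intro h
    obtain ⟨b, hb⟩ := hB
    have h1 := (memW b).1 ((mB b).2 (Or.inr hb))
    have h2 : b = 0 := by
      funext i
      have := h1 (Pi.single i 1) (h ▸ Submodule.mem_top)
      simpa [Pi.single_apply] using this
    exact hB0 (h2 ▸ hb)
  · ext x
    simp only [Finset.mem_coe, Set.mem_diff, SetLike.mem_coe, Set.mem_singleton_iff, mA]
    constructor
    · exact fun hx => ⟨Or.inr hx, fun h => hA0 (h ▸ hx)⟩
    · tauto
  · ext x
    rw [Set.mem_diff, Set.mem_setOf_eq, ← memW, mB, Set.mem_singleton_iff, Finset.mem_coe]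
    constructor
    · exact fun hx => ⟨Or.inr hx, fun h => hB0 (h ▸ hx)⟩
    · tauto
end
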